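/- arXiv:2601.11439 — 3 statements merged into one kernel-verified Lean document; each statement's English description precedes it below -/
import Mathlib

section
/- Let d ≥ 3, let G = (V,E) be a connected symmetric (undirected) graph on vertices {1,…,n}, and let A = [a_ij] be a symmetric strictly diagonally dominant weight matrix for G. If x is a fixed point of the consensus map f_A that is not a consensus configuration (i.e. not all x_i are equal), then the projected Jacobian J(x) has a real eigenvalue strictly greater than 1; hence every fixed point outside the consensus set C is unstable. -/
open scoped BigOperators

noncomputable section

/-- The conical combination `Σ_j a_ij x_j`. -/
def consSum {n d : ℕ} (A : Matrix (Fin n) (Fin n) ℝ)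
    (x : Fin n → EuclideanSpace ℝ (Fin d)) (i : Fin n) : EuclideanSpace ℝ (Fin d) :=
  ∑ j, A i j • x j

/-- The consensus map `f_A`: projection of the conical combination onto the unit sphere. -/
def consMap {n d : ℕ} (A : Matrix (Fin n) (Fin n) ℝ)
    (x : Fin n → EuclideanSpace ℝ (Fin d)) (i : Fin n) : EuclideanSpace ℝ (Fin d) :=
  ‖consSum A x i‖⁻¹ • consSum A x i

/-- The block-diagonal projection matrix `P_x` with diagonal blocks `I_d − x_i x_iᵀ`. -/
def projBlock {n d : ℕ} (x : Fin n → EuclideanSpace ℝ (Fin d)) :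
    Matrix (Fin n × Fin d) (Fin n × Fin d) ℝ :=
  Matrix.of fun p q =>
    if p.1 = q.1 then (if p.2 = q.2 then (1 : ℝ) else 0) - x p.1 p.2 * x p.1 q.2 else 0

/-- The diagonal normalization matrix `D(AX)`, with `i`-th entry `‖Σ_j a_ij x_j‖⁻¹`. -/
def Dmat {n d : ℕ} (A : Matrix (Fin n) (Fin n) ℝ)
    (x : Fin n → EuclideanSpace ℝ (Fin d)) : Matrix (Fin n) (Fin n) ℝ :=
  Matrix.diagonal fun i => ‖consSum A x i‖⁻¹

/-- The projected Jacobian `J(x) = P_{f(x)} (D(AX)A ⊗ I_d) P_x`. -/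
def Jmat {n d : ℕ} (A : Matrix (Fin n) (Fin n) ℝ)
    (x : Fin n → EuclideanSpace ℝ (Fin d)) :
    Matrix (Fin n × Fin d) (Fin n × Fin d) ℝ :=
  projBlock (consMap A x) *
    Matrix.kroneckerMap (· * ·) (Dmat A x * A) (1 : Matrix (Fin d) (Fin d) ℝ) *
    projBlock x

/-- A symmetric matrix with a Rayleigh quotient above 1 has an eigenvalue above 1. -/
lemma aux_eig {ι : Type*} [Fintype ι] [DecidableEq ι] (M : Matrix ι ι ℝ) (hM : M.IsHermitian)
    (u : ι → ℝ) (hu : u ⬝ᵥ u < u ⬝ᵥ M.mulVec u) :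
    ∃ lam : ℝ, 1 < lam ∧ ∃ v : ι → ℝ, v ≠ 0 ∧ M.mulVec v = lam • v := by
  have hN : (1 - M).IsHermitian := Matrix.isHermitian_one.sub hM
  have hnot : ¬ (1 - M).PosSemidef := by
    intro h
    have h2 := h.dotProduct_mulVec_nonneg u
    simp only [star_trivial, Matrix.sub_mulVec, Matrix.one_mulVec, dotProduct_sub] at h2
    linarith
  rw [hN.posSemidef_iff_eigenvalues_nonneg] at hnot
  obtain ⟨i, hi⟩ : ∃ i, hN.eigenvalues i < 0 := by
    by_contra h
    push Not at h
    exact hnot h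
  refine ⟨1 - hN.eigenvalues i, by linarith, WithLp.ofLp (hN.eigenvectorBasis i), ?_, ?_⟩
  · intro h
    apply hN.eigenvectorBasis.orthonormal.ne_zero i
    ext a
    exact congrFun h a
  · have := hN.mulVec_eigenvectorBasis i
    rw [Matrix.sub_mulVec, Matrix.one_mulVec] at this
    rw [sub_smul, one_smul, ← this]
    abel

/-- Generalized version with a positive diagonal weight. -/
lemma aux_gen {ι : Type*} [Fintype ι] [DecidableEq ι] (B : Matrix ι ι ℝ) (hB : B.IsSymm)
    (s : ι → ℝ) (hs : ∀ i, 0 < s i)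
    (u : ι → ℝ) (hu : ∑ i, s i * u i ^ 2 < u ⬝ᵥ B.mulVec u) :
    ∃ lam : ℝ, 1 < lam ∧ ∃ v : ι → ℝ, v ≠ 0 ∧ ∀ i, (s i)⁻¹ * B.mulVec v i = lam * v i := by
  set r : ι → ℝ := fun i => Real.sqrt (s i) with hr
  have hrpos : ∀ i, 0 < r i := fun i => Real.sqrt_pos.2 (hs i)
  have hrne : ∀ i, r i ≠ 0 := fun i => (hrpos i).ne'
  have hr2 : ∀ i, s i = r i * r i := fun i => (Real.mul_self_sqrt (hs i).le).symm
  set M : Matrix ι ι ℝ := Matrix.of fun i j => (r i)⁻¹ * B i j * (r j)⁻¹ with hMdef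
  have hM : M.IsHermitian := by
    ext i j
    have : B j i = B i j := hB.apply i j
    simp only [Matrix.conjTranspose_apply, star_trivial, hMdef, Matrix.of_apply, this]
    ring
  have hmv : ∀ w : ι → ℝ, ∀ i, M.mulVec w i = (r i)⁻¹ * B.mulVec (fun j => (r j)⁻¹ * w j) i := by
    intro w i
    simp only [Matrix.mulVec, dotProduct, hMdef, Matrix.of_apply, Finset.mul_sum]
    exact Finset.sum_congr rfl fun j _ => by ring
  obtain ⟨lam, h1, v, hv, hev⟩ := aux_eig M hM (fun i => r i * u i) (by
    have e1 : (fun i => r i * u i) ⬝ᵥ (fun i => r i * u i) = ∑ i, s i * u i ^ 2 := by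
      simp only [dotProduct]
      exact Finset.sum_congr rfl fun j _ => by rw [hr2]; ring
    have e3 : (fun j => (r j)⁻¹ * (r j * u j)) = u := by
      funext j; field_simp [hrne j]
    have e2 : (fun i => r i * u i) ⬝ᵥ M.mulVec (fun i => r i * u i) = u ⬝ᵥ B.mulVec u := by
      simp only [dotProduct, hmv, e3]
      exact Finset.sum_congr rfl fun j _ => by field_simp [hrne j]
    rw [e1, e2]; exact hu)
  refine ⟨lam, h1, fun j => (r j)⁻¹ * v j, ?_, ?_⟩
  · intro h
    apply hv
    funext j
    have := congrFun h j
    simpa [hrne j] using this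
  · intro i
    have h := congrFun hev i
    rw [hmv] at h
    simp only [Pi.smul_apply, smul_eq_mul] at h
    rw [hr2, mul_inv, mul_assoc, h]
    ring

/-- Orthogonal projection onto the complement of `y`. -/
def prj {d : ℕ} (y : Fin d → ℝ) : Matrix (Fin d) (Fin d) ℝ := 1 - Matrix.vecMulVec y y

lemma prj_symm {d : ℕ} (y : Fin d → ℝ) (a b : Fin d) : prj y a b = prj y b a := by
  simp [prj, Matrix.vecMulVec_apply, Matrix.one_apply, eq_comm, mul_comm]

lemma prj_mul {d : ℕ} (y z : Fin d → ℝ) : prj y * prj z =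
    1 - Matrix.vecMulVec y y - Matrix.vecMulVec z z + (y ⬝ᵥ z) • Matrix.vecMulVec y z := by
  rw [prj, prj, sub_mul, mul_sub, mul_sub, Matrix.vecMulVec_mul_vecMulVec]
  simp only [one_mul, mul_one, Matrix.vecMulVec_smul]
  abel

lemma prj_idem {d : ℕ} (y : Fin d → ℝ) (hy : y ⬝ᵥ y = 1) : prj y * prj y = prj y := by
  rw [prj_mul, hy, prj, one_smul]; abel

lemma prj_trace {d : ℕ} (y z : Fin d → ℝ) (hy : y ⬝ᵥ y = 1) (hz : z ⬝ᵥ z = 1) :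
    (prj y * prj z).trace = d - 2 + (y ⬝ᵥ z) ^ 2 := by
  rw [prj_mul]
  simp only [Matrix.trace_add, Matrix.trace_sub, Matrix.trace_one, Matrix.trace_smul,
    Matrix.trace_vecMulVec, hy, hz, Fintype.card_fin, smul_eq_mul]
  ring

/-- The un-normalized Jacobian. -/
def Bm {n d : ℕ} (A : Matrix (Fin n) (Fin n) ℝ) (y : Fin n → Fin d → ℝ) :
    Matrix (Fin n × Fin d) (Fin n × Fin d) ℝ :=
  Matrix.of fun p q => A p.1 q.1 * (prj (y p.1) * prj (y q.1)) p.2 q.2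

lemma projBlock_apply {n d : ℕ} (x : Fin n → EuclideanSpace ℝ (Fin d)) (p q : Fin n × Fin d) :
    projBlock x p q = if p.1 = q.1 then prj (fun a => x p.1 a) p.2 q.2 else 0 := by
  simp [projBlock, prj, Matrix.vecMulVec_apply, Matrix.one_apply]

lemma Jmat_apply {n d : ℕ} (A : Matrix (Fin n) (Fin n) ℝ)
    (x : Fin n → EuclideanSpace ℝ (Fin d)) (hfix : ∀ i, consMap A x i = x i)
    (p q : Fin n × Fin d) :
    Jmat A x p q = ‖consSum A x p.1‖⁻¹ * Bm A (fun i a => x i a) p q := by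
  have hf : consMap A x = x := funext hfix
  rw [Jmat, hf]
  simp only [Matrix.mul_apply, projBlock_apply, Fintype.sum_prod_type, Matrix.kroneckerMap_apply,
    Dmat, Matrix.diagonal_apply, Matrix.one_apply, Bm, Matrix.of_apply]
  simp [Finset.mul_sum, Finset.sum_mul, ite_mul, mul_ite]
  exact Finset.sum_congr rfl fun j _ => by ring

lemma quad_sum {n d : ℕ} (A : Matrix (Fin n) (Fin n) ℝ) (y : Fin n → Fin d → ℝ)
    (hy : ∀ i, y i ⬝ᵥ y i = 1) :
    ∑ k, (fun p : Fin n × Fin d => prj (y p.1) p.2 k) ⬝ᵥ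
      (Bm A y).mulVec (fun p : Fin n × Fin d => prj (y p.1) p.2 k)
      = ∑ i, ∑ j, A i j * (d - 2 + (y i ⬝ᵥ y j) ^ 2) := by
  have key : ∀ k, (fun p : Fin n × Fin d => prj (y p.1) p.2 k) ⬝ᵥ
      (Bm A y).mulVec (fun p : Fin n × Fin d => prj (y p.1) p.2 k)
      = ∑ i, ∑ j, A i j * (prj (y i) * prj (y j)) k k := by
    intro k
    simp only [dotProduct, Matrix.mulVec, Fintype.sum_prod_type, Bm, Matrix.of_apply]
    refine Finset.sum_congr rfl fun i _ => ?_
    have h : ∀ j, (prj (y i) * prj (y j)) k k =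
        ∑ a, prj (y i) a k * ∑ b, (prj (y i) * prj (y j)) a b * prj (y j) b k := by
      intro j
      have e : prj (y i) * prj (y j) = prj (y i) * (prj (y i) * prj (y j) * prj (y j)) := by
        rw [mul_assoc, prj_idem _ (hy j), ← mul_assoc, prj_idem _ (hy i)]
      conv_lhs => rw [e]
      rw [Matrix.mul_apply]
      refine Finset.sum_congr rfl fun a _ => ?_
      rw [prj_symm, Matrix.mul_apply (M := prj (y i) * prj (y j))]
    simp only [h, Finset.mul_sum]
    rw [Finset.sum_comm]
    refine Finset.sum_congr rfl fun j _ => Finset.sum_congr rfl fun a _ =>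
      Finset.sum_congr rfl fun b _ => by ring
  simp only [key]
  rw [Finset.sum_comm]
  refine Finset.sum_congr rfl fun i _ => ?_
  rw [Finset.sum_comm]
  refine Finset.sum_congr rfl fun j _ => ?_
  rw [← Finset.mul_sum, ← prj_trace _ _ (hy i) (hy j), Matrix.trace]
  rfl

lemma diag_sum {n d : ℕ} (s : Fin n → ℝ) (y : Fin n → Fin d → ℝ)
    (hy : ∀ i, y i ⬝ᵥ y i = 1) :
    ∑ k, ∑ p : Fin n × Fin d, s p.1 * prj (y p.1) p.2 k ^ 2 = ∑ i, s i * (d - 1) := by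
  simp only [Fintype.sum_prod_type]
  rw [Finset.sum_comm]
  refine Finset.sum_congr rfl fun i _ => ?_
  have h := prj_trace _ _ (hy i) (hy i)
  rw [hy i] at h
  have h2 : (d : ℝ) - 1 = ∑ k, ∑ a, prj (y i) a k ^ 2 := by
    have e : (d : ℝ) - 1 = d - 2 + 1 ^ 2 := by ring
    rw [e, ← h, Matrix.trace]
    refine Finset.sum_congr rfl fun k _ => ?_
    rw [Matrix.diag_apply, Matrix.mul_apply]
    exact Finset.sum_congr rfl fun a _ => by rw [prj_symm _ k a]; ring
  rw [h2, Finset.mul_sum]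
  exact Finset.sum_congr rfl fun k _ => by rw [Finset.mul_sum]

/-- for `d ≥ 3`, a connected symmetric graph and a symmetric strictly
diagonally dominant weight matrix, every fixed point of `f_A` that is not a consensus
configuration has a projected Jacobian `J(x)` with a real eigenvalue strictly greater
than `1`; hence every non-consensus fixed point is unstable. -/
theorem stmt_14 (n d : ℕ) (hn : 1 ≤ n) (hd : 3 ≤ d)
    (E : Fin n → Fin n → Prop)
    (hEsym : ∀ i j, E i j → E j i)
    (hconn : ∀ i j, Relation.ReflTransGen E i j)
    (A : Matrix (Fin n) (Fin n) ℝ)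
    (hAsym : A.IsSymm)
    (hApos : ∀ i j, 0 ≤ A i j)
    (hAE : ∀ i j, i ≠ j → (0 < A i j ↔ E i j))
    (hdd : ∀ i, ∑ j ∈ Finset.univ.erase i, A i j < A i i)
    (x : Fin n → EuclideanSpace ℝ (Fin d)) (hx : ∀ i, ‖x i‖ = 1)
    (hfix : ∀ i, consMap A x i = x i)
    (hnotcons : ¬ ∀ i j, x i = x j) :
    ∃ lam : ℝ, 1 < lam ∧ ∃ v : Fin n × Fin d → ℝ, v ≠ 0 ∧
      (Jmat A x).mulVec v = lam • v := by
  set y : Fin n → Fin d → ℝ := fun i a => x i a with hydef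
  have hin : ∀ i j, inner ℝ (x i) (x j) = y i ⬝ᵥ y j := by
    intro i j
    simp only [PiLp.inner_apply, dotProduct, hydef]
    exact Finset.sum_congr rfl fun a _ => by simp [mul_comm]
  have hy : ∀ i, y i ⬝ᵥ y i = 1 := by
    intro i
    rw [← hin, real_inner_self_eq_norm_sq, hx]; norm_num
  have hspos : ∀ i, 0 < ‖consSum A x i‖ := by
    intro i
    rw [norm_pos_iff]
    intro h
    have h1 := hfix i
    rw [consMap, h, smul_zero] at h1
    have h2 := hx i
    rw [← h1, norm_zero] at h2
    norm_num at h2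
  have hs : ∀ i, ‖consSum A x i‖ = ∑ j, A i j * (y i ⬝ᵥ y j) := by
    intro i
    have h1 : consSum A x i = ‖consSum A x i‖ • x i := by
      conv_rhs => rw [← hfix i, consMap]
      rw [smul_smul, mul_inv_cancel₀ (hspos i).ne', one_smul]
    have h2 : inner ℝ (x i) (consSum A x i) = ‖consSum A x i‖ := by
      conv_lhs => rw [h1]
      rw [inner_smul_right, hin, hy, mul_one]
    rw [← h2, consSum, inner_sum]
    exact Finset.sum_congr rfl fun j _ => by rw [inner_smul_right, hin]
  have hle : ∀ i j, y i ⬝ᵥ y j ≤ 1 := by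
    intro i j
    rw [← hin]
    have := real_inner_le_norm (x i) (x j)
    simpa [hx] using this
  obtain ⟨i₀, j₀, hE, hne⟩ : ∃ i j, E i j ∧ x i ≠ x j := by
    by_contra h
    push Not at h
    apply hnotcons
    intro i j
    induction hconn i j with
    | refl => rfl
    | tail _ hbc ih => exact ih.trans (h _ _ hbc)
  have hij : i₀ ≠ j₀ := fun h => hne (by rw [h])
  have hd3 : (3 : ℝ) ≤ d := by exact_mod_cast hd
  have hlt : y i₀ ⬝ᵥ y j₀ < 1 := by
    refine lt_of_le_of_ne (hle _ _) fun h => hne ?_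
    rw [← hin] at h
    exact (inner_eq_one_iff_of_norm_eq_one (hx i₀) (hx j₀)).1 h
  have hterm : ∀ i j, 0 ≤ A i j * ((1 - y i ⬝ᵥ y j) * (d - 2 - y i ⬝ᵥ y j)) := by
    intro i j
    have := hle i j
    exact mul_nonneg (hApos i j) (mul_nonneg (by linarith) (by linarith))
  have hpos : 0 < ∑ i, ∑ j, A i j * ((1 - y i ⬝ᵥ y j) * (d - 2 - y i ⬝ᵥ y j)) := by
    refine Finset.sum_pos' (fun i _ => Finset.sum_nonneg fun j _ => hterm i j)
      ⟨i₀, Finset.mem_univ _, Finset.sum_pos' (fun j _ => hterm i₀ j) ⟨j₀, Finset.mem_univ _, ?_⟩⟩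
    exact mul_pos ((hAE _ _ hij).2 hE) (mul_pos (by linarith) (by linarith))
  obtain ⟨k, hk⟩ : ∃ k : Fin d, ∑ p : Fin n × Fin d, ‖consSum A x p.1‖ * prj (y p.1) p.2 k ^ 2 <
      (fun p : Fin n × Fin d => prj (y p.1) p.2 k) ⬝ᵥ
      (Bm A y).mulVec (fun p : Fin n × Fin d => prj (y p.1) p.2 k) := by
    by_contra h
    push Not at h
    have h1 := Finset.sum_le_sum fun k (_ : k ∈ Finset.univ) => h k
    rw [quad_sum A y hy, diag_sum (fun i => ‖consSum A x i‖) y hy] at h1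
    have h2 : ∑ i, ∑ j, A i j * ((1 - y i ⬝ᵥ y j) * (d - 2 - y i ⬝ᵥ y j)) =
        ∑ i, ∑ j, A i j * (d - 2 + (y i ⬝ᵥ y j) ^ 2) - ∑ i, ‖consSum A x i‖ * (d - 1) := by
      rw [← Finset.sum_sub_distrib]
      refine Finset.sum_congr rfl fun i _ => ?_
      rw [hs, Finset.sum_mul, ← Finset.sum_sub_distrib]
      exact Finset.sum_congr rfl fun j _ => by ring
    linarith
  have hBsymm : (Bm A y).IsSymm := by
    ext p q
    have h1 : A q.1 p.1 = A p.1 q.1 := hAsym.apply _ _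
    simp only [Matrix.transpose_apply, Bm, Matrix.of_apply, h1, Matrix.mul_apply]
    congr 1
    refine Finset.sum_congr rfl fun c _ => ?_
    rw [prj_symm _ q.2 c, prj_symm _ c p.2, mul_comm]
  obtain ⟨lam, h1, v, hv, hev⟩ := aux_gen (Bm A y) hBsymm (fun p => ‖consSum A x p.1‖)
    (fun p => hspos p.1) _ hk
  refine ⟨lam, h1, v, hv, ?_⟩
  funext p
  rw [Pi.smul_apply, smul_eq_mul, ← hev p]
  simp only [Matrix.mulVec, dotProduct, Jmat_apply A x hfix, Finset.mul_sum]
  exact Finset.sum_congr rfl fun q _ => by rw [mul_assoc]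

end
end

section
/- Let d ≥ 3, let G = (V,E) be a connected symmetric (undirected) graph on vertices {1,…,n}, and let A = [a_ij] be a symmetric weight matrix for G satisfying a_ii > √2 · Σ_{j≠i} a_ij for every i. Identify configurations with points of ℝ^{nd}. Then the set { x : there exists a fixed point x_∞ of f_A that is not a consensus configuration such that f_A^k(x) → x_∞ as k → ∞ } has n(d−1)-dimensional Hausdorff measure zero in ℝ^{nd}. -/
open scoped BigOperators
open MeasureTheory

noncomputable section

/-- Hausdorff null sets pull back along maps that are antilipschitz on a set. -/
lemma hnull_of_anti {X Y : Type*} [MetricSpace X] [MeasurableSpace X] [BorelSpace X]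
    [MetricSpace Y] [MeasurableSpace Y] [BorelSpace Y] (g : X → Y) (s : Set X) (C r : ℝ)
    (hr : 0 ≤ r) (h : ∀ y ∈ s, ∀ z ∈ s, dist y z ≤ C * dist (g y) (g z))
    (h0 : μH[r] (g '' s) = 0) : μH[r] s = 0 := by
  classical
  rcases s.eq_empty_or_nonempty with rfl | ⟨x0, hx0⟩
  · simp
  have : Nonempty X := ⟨x0⟩
  have hinj : Set.InjOn g s := by
    intro y hy z hz hyz
    have := h y hy z hz
    rw [hyz, dist_self, mul_zero] at this
    exact dist_le_zero.1 this
  have hl : LipschitzOnWith (Real.toNNReal C) (Function.invFunOn g s) (g '' s) := by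
    apply LipschitzOnWith.of_dist_le_mul
    rintro _ ⟨y, hy, rfl⟩ _ ⟨z, hz, rfl⟩
    rw [hinj.leftInvOn_invFunOn hy, hinj.leftInvOn_invFunOn hz]
    refine (h y hy z hz).trans ?_
    gcongr
    exact Real.le_coe_toNNReal C
  have := hl.hausdorffMeasure_image_le hr
  rw [h0, mul_zero, hinj.leftInvOn_invFunOn.image_image] at this
  exact le_antisymm this bot_le

/-- Abstract unstable-set lemma. -/
lemma unstable_null {X : Type*} [MetricSpace X] [MeasurableSpace X] [BorelSpace X]
    {m N : ℕ} (hmN : m ≤ N) (f : X → X) (M U : Set X) (hf : ∀ x ∈ M, f x ∈ M)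
    (κ : X → (Fin m → ℝ)) (C : ℝ) (μ : Fin m → ℝ) (c ε R : ℝ) (hc : 1 + ε < c - ε)
    (hε : 0 < ε)
    (hμ : ∀ i, 1 < |μ i| → c ≤ |μ i|) (hex : ∃ i, 1 < |μ i|)
    (hanti : ∀ y ∈ M ∩ U, ∀ z ∈ M ∩ U, dist y z ≤ C * dist (κ y) (κ z))
    (hder : ∀ y ∈ M ∩ U, ∀ z ∈ M ∩ U, ∀ i,
      |(κ (f y) i - κ (f z) i) - μ i * (κ y i - κ z i)| ≤ ε * dist (κ y) (κ z))
    (hR : ∀ y ∈ M ∩ U, ∀ z ∈ M ∩ U, dist (κ y) (κ z) ≤ R) :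
    μH[(N : ℝ)] {x | x ∈ M ∧ ∀ k, f^[k] x ∈ U} = 0 := by
  classical
  set W := {x | x ∈ M ∧ ∀ k, f^[k] x ∈ U} with hW
  have hWf : ∀ x ∈ W, ∀ k, f^[k] x ∈ W := by
    intro x hx k
    refine ⟨?_, fun l => ?_⟩
    · induction k with
      | zero => exact hx.1
      | succ k ih => rw [Function.iterate_succ_apply']; exact hf _ ih
    · rw [← Function.iterate_add_apply]; exact hx.2 _
  have hWU : ∀ x ∈ W, x ∈ M ∩ U := fun x hx => ⟨hx.1, hx.2 0⟩
  have hne : (Finset.univ : Finset (Fin m)).Nonempty := ⟨hex.choose, Finset.mem_univ _⟩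
  have hmax : ∀ w w' : Fin m → ℝ, ∃ i, dist w w' = |w i - w' i| := by
    intro w w'
    obtain ⟨i, -, hi⟩ := Finset.exists_max_image Finset.univ (fun i => |w i - w' i|) hne
    refine ⟨i, le_antisymm ?_ ?_⟩
    · rw [dist_pi_le_iff (abs_nonneg _)]
      intro b
      rw [Real.dist_eq]; exact hi b (Finset.mem_univ _)
    · have := dist_le_pi_dist w w' i
      rwa [Real.dist_eq] at this
  have hle : ∀ (w w' : Fin m → ℝ) i, |w i - w' i| ≤ dist w w' := by
    intro w w' i
    have := dist_le_pi_dist w w' i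
    rwa [Real.dist_eq] at this
  have step : ∀ y ∈ W, ∀ z ∈ W, 0 < dist (κ y) (κ z) →
      (∃ i, 1 < |μ i| ∧ dist (κ y) (κ z) = |κ y i - κ z i|) →
      (c - ε) * dist (κ y) (κ z) ≤ dist (κ (f y)) (κ (f z)) ∧
      (∃ i, 1 < |μ i| ∧ dist (κ (f y)) (κ (f z)) = |κ (f y) i - κ (f z) i|) := by
    rintro y hy z hz hpos ⟨i, hi1, hi⟩
    have hd := hder y (hWU y hy) z (hWU z hz)
    set δ := dist (κ y) (κ z) with hδ
    have h1 : (c - ε) * δ ≤ |κ (f y) i - κ (f z) i| := by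
      have h2 := hd i
      have h3 : |μ i * (κ y i - κ z i)| = |μ i| * δ := by rw [abs_mul, ← hi]
      have h4 : c * δ ≤ |μ i| * δ := mul_le_mul_of_nonneg_right (hμ i hi1) hpos.le
      have h5 := abs_sub_abs_le_abs_sub (μ i * (κ y i - κ z i)) (κ (f y) i - κ (f z) i)
      rw [abs_sub_comm (μ i * (κ y i - κ z i))] at h5
      linarith
    refine ⟨h1.trans (hle _ _ i), ?_⟩
    obtain ⟨j, hj⟩ := hmax (κ (f y)) (κ (f z))
    refine ⟨j, ?_, hj⟩
    by_contra hcon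
    push Not at hcon
    have h2 := hd j
    have h3 : |μ j * (κ y j - κ z j)| ≤ 1 * δ := by
      rw [abs_mul]; exact mul_le_mul hcon (hle _ _ j) (abs_nonneg _) zero_le_one
    have h5 := abs_sub_abs_le_abs_sub (κ (f y) j - κ (f z) j) (μ j * (κ y j - κ z j))
    have h6 := (hle (κ (f y)) (κ (f z)) i)
    nlinarith
  have key : ∀ y ∈ W, ∀ z ∈ W, y ≠ z →
      ¬ ∃ i, 1 < |μ i| ∧ dist (κ y) (κ z) = |κ y i - κ z i| := by
    intro y hy z hz hyz hcon
    have hpos : 0 < dist (κ y) (κ z) := by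
      have h1 := hanti y (hWU y hy) z (hWU z hz)
      have h2 := dist_pos.2 hyz
      rcases (dist_nonneg (x := κ y) (y := κ z)).eq_or_lt with h | h
      · rw [← h, mul_zero] at h1; linarith
      · exact h
    have hc1 : 1 < c - ε := by linarith
    have hk : ∀ k : ℕ, (c - ε) ^ k * dist (κ y) (κ z) ≤ dist (κ (f^[k] y)) (κ (f^[k] z)) ∧
        ∃ i, 1 < |μ i| ∧
          dist (κ (f^[k] y)) (κ (f^[k] z)) = |κ (f^[k] y) i - κ (f^[k] z) i| := by
      intro k
      induction k with
      | zero => simpa using hcon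
      | succ k ih =>
        have hp : 0 < dist (κ (f^[k] y)) (κ (f^[k] z)) :=
          lt_of_lt_of_le (by positivity) ih.1
        have := step _ (hWf y hy k) _ (hWf z hz k) hp ih.2
        rw [Function.iterate_succ_apply', Function.iterate_succ_apply']
        refine ⟨?_, this.2⟩
        refine le_trans ?_ this.1
        rw [pow_succ']
        have := mul_le_mul_of_nonneg_left ih.1 (by linarith : 0 ≤ c - ε)
        linarith
    obtain ⟨k, hk'⟩ := pow_unbounded_of_one_lt (R / dist (κ y) (κ z)) hc1
    rw [div_lt_iff₀ hpos] at hk'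
    have := hR _ (hWU _ (hWf y hy k)) _ (hWU _ (hWf z hz k))
    linarith [(hk k).1]
  let π : X → ({j : Fin m // ¬ 1 < |μ j|} → ℝ) := fun x j => κ x j
  have hπ : ∀ y ∈ W, ∀ z ∈ W, dist y z ≤ C * dist (π y) (π z) := by
    intro y hy z hz
    rcases eq_or_ne y z with rfl | hyz
    · simp
    obtain ⟨i, hi⟩ := hmax (κ y) (κ z)
    have hi' : ¬ 1 < |μ i| := fun h => key y hy z hz hyz ⟨i, h, hi⟩
    have h1 := hanti y (hWU y hy) z (hWU z hz)
    have h2 : dist (κ y) (κ z) = dist (π y) (π z) := by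
      apply le_antisymm
      · rw [hi]
        have := dist_le_pi_dist (π y) (π z) ⟨i, hi'⟩
        rwa [Real.dist_eq] at this
      · rw [dist_pi_le_iff dist_nonneg]
        intro j
        exact dist_le_pi_dist (κ y) (κ z) j
    rwa [← h2]
  refine hnull_of_anti π W C N (by positivity) hπ ?_
  apply hausdorffMeasure_of_dimH_lt (d := (N : NNReal))
  refine lt_of_le_of_lt (dimH_mono (Set.subset_univ _)) ?_
  rw [Real.dimH_univ_pi]
  have : Fintype.card {j : Fin m // ¬ 1 < |μ j|} < m := by
    obtain ⟨i, hi⟩ := hex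
    have := Fintype.card_subtype_lt (p := fun j : Fin m => ¬ 1 < |μ j|) (x := i) (by simpa using hi)
    simpa using this
  exact_mod_cast lt_of_lt_of_le this hmN

/-- Space of all tuples of vectors. -/
abbrev CX (n d : ℕ) := Fin n → EuclideanSpace ℝ (Fin d)

/-- The configuration manifold. -/
def CM (n d : ℕ) : Set (CX n d) := {x | ∀ i, ‖x i‖ = 1}

/-- Tangency at `x`. -/
def IsTan {n d : ℕ} (x v : CX n d) : Prop := ∀ i, inner ℝ (x i) (v i) = 0

/-- Differences of nearby configurations are nearly tangent. -/
lemma near_tangent {n d : ℕ} (x : CX n d) (ε : ℝ) (hε : 0 < ε) :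
    ∀ᶠ q : CX n d × CX n d in nhds (x, x), q.1 ∈ CM n d → q.2 ∈ CM n d →
      ∀ i, |inner ℝ (x i) (q.1 i - q.2 i)| ≤ ε * ‖q.1 - q.2‖ := by
  have h : Metric.ball (x, x) ε ∈ nhds (x, x) := Metric.ball_mem_nhds _ hε
  filter_upwards [h] with q hq h1 h2 i
  obtain ⟨y, z⟩ := q
  rw [Metric.mem_ball, Prod.dist_eq, max_lt_iff] at hq
  simp only at hq h1 h2 ⊢
  have hy : ‖x i - y i‖ ≤ ε := by
    rw [norm_sub_rev, ← dist_eq_norm]; exact (dist_le_pi_dist y x i).trans hq.1.le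
  have hz : ‖x i - z i‖ ≤ ε := by
    rw [norm_sub_rev, ← dist_eq_norm]; exact (dist_le_pi_dist z x i).trans hq.2.le
  have hw : ‖y i - z i‖ ≤ ‖y - z‖ := norm_le_pi_norm (y - z) i
  have e : inner ℝ (x i) (y i - z i) =
      (1/2) * inner ℝ ((x i - y i) + (x i - z i)) (y i - z i) := by
    have e1 : inner ℝ (y i) (y i) = (1:ℝ) := by rw [real_inner_self_eq_norm_sq, h1 i]; norm_num
    have e2 : inner ℝ (z i) (z i) = (1:ℝ) := by rw [real_inner_self_eq_norm_sq, h2 i]; norm_num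
    simp only [inner_add_left, inner_sub_left, inner_sub_right, e1, e2, real_inner_comm (y i) (z i)]
    ring
  rw [e, abs_mul]
  have h3 := abs_real_inner_le_norm ((x i - y i) + (x i - z i)) (y i - z i)
  have h4 := norm_add_le (x i - y i) (x i - z i)
  have h5 : ‖(x i - y i) + (x i - z i)‖ * ‖y i - z i‖ ≤ (2 * ε) * ‖y - z‖ :=
    mul_le_mul (by linarith) hw (norm_nonneg _) (by positivity)
  rw [abs_of_pos (by norm_num : (0:ℝ) < 1/2)]
  linarith

/-- A linear map vanishing on the tangent space is small on differences. -/
lemma small_of_vanish {n d : ℕ} {Y : Type*} [NormedAddCommGroup Y] [NormedSpace ℝ Y]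
    (x : CX n d) (hx : x ∈ CM n d) (R : CX n d →L[ℝ] Y) (hR : ∀ v, IsTan x v → R v = 0)
    (ε : ℝ) (hε : 0 < ε) :
    ∀ᶠ q : CX n d × CX n d in nhds (x, x), q.1 ∈ CM n d → q.2 ∈ CM n d →
      ‖R (q.1 - q.2)‖ ≤ ε * ‖q.1 - q.2‖ := by
  have hK : 0 < ‖R‖ + 1 := by positivity
  filter_upwards [near_tangent x (ε / (‖R‖ + 1)) (by positivity)] with q hq h1 h2
  have h := hq h1 h2
  set w := q.1 - q.2 with hw
  let u : CX n d := fun i => (inner ℝ (x i) (w i) : ℝ) • x i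
  have hu : R w = R u := by
    have : R (w - u) = 0 := by
      apply hR
      intro i
      simp only [Pi.sub_apply, u, inner_sub_right, inner_smul_right, real_inner_self_eq_norm_sq,
        hx i]
      ring
    rw [map_sub] at this
    exact sub_eq_zero.1 this
  have hun : ‖u‖ ≤ ε / (‖R‖ + 1) * ‖w‖ := by
    rw [pi_norm_le_iff_of_nonneg (by positivity)]
    intro i
    simp only [u, norm_smul, hx i, mul_one, Real.norm_eq_abs]
    exact h i
  rw [hu]
  calc ‖R u‖ ≤ ‖R‖ * ‖u‖ := R.le_opNorm u
    _ ≤ (‖R‖ + 1) * (ε / (‖R‖ + 1) * ‖w‖) := by gcongr; linarith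
    _ = ε * ‖w‖ := by field_simp

/-- A linear map injective on the tangent space is antilipschitz on differences. -/
lemma anti_of_inj {n d : ℕ} {Y : Type*} [NormedAddCommGroup Y] [NormedSpace ℝ Y]
    (x : CX n d) (L : CX n d →L[ℝ] Y) (hL : ∀ v, IsTan x v → L v = 0 → v = 0) :
    ∃ C > 0, ∀ᶠ q : CX n d × CX n d in nhds (x, x), q.1 ∈ CM n d → q.2 ∈ CM n d →
      ‖q.1 - q.2‖ ≤ C * ‖L (q.1 - q.2)‖ := by
  let I : CX n d →L[ℝ] (Fin n → ℝ) := ContinuousLinearMap.pi fun i =>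
    (innerSL ℝ (x i)).comp (ContinuousLinearMap.proj i)
  have hI : ∀ v i, I v i = inner ℝ (x i) (v i) := fun v i => rfl
  let G : CX n d →L[ℝ] Y × (Fin n → ℝ) := L.prod I
  have hG : LinearMap.ker (G : CX n d →ₗ[ℝ] Y × (Fin n → ℝ)) = ⊥ := by
    rw [LinearMap.ker_eq_bot']
    intro v hv
    have h1 : L v = 0 := congrArg Prod.fst hv
    have h2 : I v = 0 := congrArg Prod.snd hv
    exact hL v (fun i => by rw [← hI, h2]; rfl) h1
  obtain ⟨K, hK, hGK⟩ := LinearMap.exists_antilipschitzWith _ hG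
  have hK0 : (0 : ℝ) < K := by exact_mod_cast hK
  refine ⟨2 * K, by positivity, ?_⟩
  filter_upwards [near_tangent x (1 / (2 * K)) (by positivity)] with q hq h1 h2
  have h := hq h1 h2
  set w := q.1 - q.2 with hw
  have h3 : ‖w‖ ≤ K * ‖G w‖ := by
    have := hGK.le_mul_dist w 0
    rw [map_zero, dist_zero_right, dist_zero_right] at this
    exact this
  have h4 : ‖G w‖ ≤ ‖L w‖ + 1 / (2 * K) * ‖w‖ := by
    have : ‖I w‖ ≤ 1 / (2 * K) * ‖w‖ := by
      rw [pi_norm_le_iff_of_nonneg (by positivity)]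
      exact h
    have e : ‖G w‖ = max ‖L w‖ ‖I w‖ := rfl
    rw [e]
    refine max_le ?_ ?_
    · have : 0 ≤ 1 / (2 * K) * ‖w‖ := by positivity
      linarith
    · linarith [norm_nonneg (L w)]
  have h5 : ‖w‖ ≤ K * ‖L w‖ + 1/2 * ‖w‖ := by
    calc ‖w‖ ≤ K * (‖L w‖ + 1 / (2 * K) * ‖w‖) := h3.trans (by gcongr)
      _ = K * ‖L w‖ + 1/2 * ‖w‖ := by field_simp
  linarith

/-- Strict derivative of the consensus map. -/
lemma consMap_deriv {n d : ℕ} (A : Matrix (Fin n) (Fin n) ℝ) (x : CX n d)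
    (hs : ∀ i, consSum A x i ≠ 0) :
    ∃ L : CX n d →L[ℝ] CX n d, HasStrictFDerivAt (consMap A) L x ∧
      ∀ v i, L v i = ‖consSum A x i‖⁻¹ •
        (consSum A v i - (inner ℝ (consMap A x i) (consSum A v i) : ℝ) • consMap A x i) := by
  let S : Fin n → (CX n d →L[ℝ] EuclideanSpace ℝ (Fin d)) := fun i =>
    ∑ j, A i j • ContinuousLinearMap.proj j
  have hS : ∀ i v, S i v = consSum A v i := by
    intro i v; simp [S, consSum]
  have key : ∀ i, ∃ L : CX n d →L[ℝ] EuclideanSpace ℝ (Fin d),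
      HasStrictFDerivAt (fun y => consMap A y i) L x ∧ ∀ v, L v = ‖consSum A x i‖⁻¹ •
        (consSum A v i - (inner ℝ (consMap A x i) (consSum A v i) : ℝ) • consMap A x i) := by
    intro i
    have h1 : HasStrictFDerivAt (fun y : CX n d => consSum A y i) (S i) x := by
      have e : (fun y : CX n d => consSum A y i) = S i := funext fun y => (hS i y).symm
      rw [e]
      exact (S i).hasStrictFDerivAt
    have hn0 : ‖consSum A x i‖ ≠ 0 := norm_ne_zero_iff.2 (hs i)
    have h2 := (((hasStrictFDerivAt_norm_sq (consSum A x i)).comp x h1).sqrt (pow_ne_zero 2 hn0))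
    simp only [Real.sqrt_sq (norm_nonneg _)] at h2
    have h3 := (hasStrictDerivAt_inv hn0).comp_hasStrictFDerivAt x h2
    have h4 := h3.smul h1
    refine ⟨_, h4, ?_⟩
    intro v
    simp [hS, consMap, inner_smul_left, smul_smul, smul_sub]
    module
  choose L hL hL' using key
  refine ⟨ContinuousLinearMap.pi L, ?_, fun v i => hL' i v⟩
  exact hasStrictFDerivAt_pi'.2 fun i => hL i

lemma exists_open_of_eventually_prod {X : Type*} [TopologicalSpace X] {x : X} {P : X × X → Prop}
    (h : ∀ᶠ q in nhds (x, x), P q) : ∃ U, IsOpen U ∧ x ∈ U ∧ ∀ y ∈ U, ∀ z ∈ U, P (y, z) := by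
  rw [nhds_prod_eq, Filter.eventually_prod_self_iff'] at h
  obtain ⟨t, ht, h⟩ := h
  obtain ⟨U, hU, hUo, hx⟩ := mem_nhds_iff.1 ht
  exact ⟨U, hUo, hx, fun y hy z hz => h y (hU hy) z (hU hz)⟩

/-- Squared norm of the component orthogonal to a unit vector. -/
lemma norm_sq_perp {d : ℕ} (f w : EuclideanSpace ℝ (Fin d)) (hf : ‖f‖ = 1) :
    ‖w - (inner ℝ f w : ℝ) • f‖ ^ 2 = ‖w‖ ^ 2 - (inner ℝ f w : ℝ) ^ 2 := by
  rw [norm_sub_sq_real, norm_smul, inner_smul_right, hf, real_inner_comm, mul_one,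
    Real.norm_eq_abs, sq_abs]
  ring

lemma bessel_two {d : ℕ} (f x v : EuclideanSpace ℝ (Fin d)) (hf : ‖f‖ = 1) (hx : ‖x‖ = 1)
    (hxv : inner ℝ x v = (0 : ℝ)) :
    (inner ℝ f x : ℝ) ^ 2 * ‖v‖ ^ 2 + (inner ℝ f v : ℝ) ^ 2 ≤ ‖v‖ ^ 2 := by
  set t := ‖v‖ with ht
  set p := (inner ℝ f x : ℝ)
  set q := (inner ℝ f v : ℝ)
  set g := (p * t ^ 2) • x + q • v with hg
  have h1 : inner ℝ f g = p ^ 2 * t ^ 2 + q ^ 2 := by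
    simp only [hg, inner_add_right, inner_smul_right]
    change p * t ^ 2 * p + q * q = _
    ring
  have h2 : ‖g‖ ^ 2 = t ^ 2 * (p ^ 2 * t ^ 2 + q ^ 2) := by
    rw [hg, norm_add_sq_real, norm_smul, norm_smul, inner_smul_left, inner_smul_right, hxv, hx,
      mul_pow, mul_pow, Real.norm_eq_abs, Real.norm_eq_abs, sq_abs, sq_abs, ← ht]
    simp
    ring
  have h3 : (inner ℝ f g : ℝ) ^ 2 ≤ ‖g‖ ^ 2 := by
    have := norm_sq_perp f g hf
    nlinarith [sq_nonneg ‖g - (inner ℝ f g : ℝ) • f‖]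
  rw [h1, h2] at h3
  set β := p ^ 2 * t ^ 2 + q ^ 2 with hβ
  have hβ0 : 0 ≤ β := by positivity
  by_contra hcon
  push Not at hcon
  nlinarith [sq_nonneg t]

lemma consSum_split {n d : ℕ} (A : Matrix (Fin n) (Fin n) ℝ) (w : CX n d) (i : Fin n) :
    consSum A w i = A i i • w i + ∑ j ∈ Finset.univ.erase i, A i j • w j := by
  rw [consSum, ← Finset.add_sum_erase _ _ (Finset.mem_univ i)]

lemma rest_norm_le {n d : ℕ} (A : Matrix (Fin n) (Fin n) ℝ) (hApos : ∀ i j, 0 ≤ A i j)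
    (w : CX n d) (i : Fin n) (t : ℝ) (hw : ∀ j, ‖w j‖ ≤ t) :
    ‖∑ j ∈ Finset.univ.erase i, A i j • w j‖ ≤ (∑ j ∈ Finset.univ.erase i, A i j) * t := by
  rw [Finset.sum_mul]
  refine norm_sum_le_of_le _ fun j _ => ?_
  rw [norm_smul, Real.norm_eq_abs, abs_of_nonneg (hApos i j)]
  exact mul_le_mul_of_nonneg_left (hw j) (hApos i j)

lemma perp_bound {n d : ℕ} (A : Matrix (Fin n) (Fin n) ℝ) (hApos : ∀ i j, 0 ≤ A i j)
    (w : CX n d) (i : Fin n) (t : ℝ) (hw : ∀ j, ‖w j‖ ≤ t) (hwi : ‖w i‖ = t)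
    (f : EuclideanSpace ℝ (Fin d)) (hf : ‖f‖ = 1)
    (h0 : consSum A w i - (inner ℝ f (consSum A w i) : ℝ) • f = 0) :
    A i i ^ 2 * (t ^ 2 - (inner ℝ f (w i) : ℝ) ^ 2) ≤
      (∑ j ∈ Finset.univ.erase i, A i j) ^ 2 * t ^ 2 := by
  have hr := rest_norm_le A hApos w i t hw
  rw [consSum_split] at h0
  set ρ := ∑ j ∈ Finset.univ.erase i, A i j • w j
  set r := ∑ j ∈ Finset.univ.erase i, A i j
  have e : A i i • (w i - (inner ℝ f (w i) : ℝ) • f) = -(ρ - (inner ℝ f ρ : ℝ) • f) := by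
    rw [inner_add_right, inner_smul_right] at h0
    rw [eq_neg_iff_add_eq_zero, ← h0]
    module
  have e2 := congrArg (fun u => ‖u‖ ^ 2) e
  simp only [norm_smul, norm_neg, mul_pow, norm_sq_perp _ _ hf, Real.norm_eq_abs, sq_abs, hwi] at e2
  rw [e2, ← mul_pow]
  have : ‖ρ‖ ^ 2 ≤ (r * t) ^ 2 := pow_le_pow_left₀ (norm_nonneg _) hr 2
  linarith [sq_nonneg (inner ℝ f ρ : ℝ)]

lemma consSum_ne {n d : ℕ} (A : Matrix (Fin n) (Fin n) ℝ)
    (hApos : ∀ i j, 0 ≤ A i j)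
    (hdd : ∀ i, Real.sqrt 2 * ∑ j ∈ Finset.univ.erase i, A i j < A i i)
    (x : CX n d) (hx : x ∈ CM n d) (i : Fin n) : consSum A x i ≠ 0 := by
  intro h
  have hr := rest_norm_le A hApos x i 1 (fun j => (hx j).le)
  have hr0 : 0 ≤ ∑ j ∈ Finset.univ.erase i, A i j := Finset.sum_nonneg fun j _ => hApos i j
  rw [consSum_split, add_eq_zero_iff_eq_neg] at h
  have h2 := congrArg norm h
  rw [norm_smul, norm_neg, hx i, Real.norm_eq_abs, abs_of_nonneg (hApos i i)] at h2
  have h3 := hdd i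
  have h4 : (1:ℝ) ≤ Real.sqrt 2 := Real.one_le_sqrt.2 (by norm_num)
  nlinarith

lemma consMap_mem {n d : ℕ} (A : Matrix (Fin n) (Fin n) ℝ)
    (hApos : ∀ i j, 0 ≤ A i j)
    (hdd : ∀ i, Real.sqrt 2 * ∑ j ∈ Finset.univ.erase i, A i j < A i i)
    (x : CX n d) (hx : x ∈ CM n d) : consMap A x ∈ CM n d := by
  intro i
  have := norm_ne_zero_iff.2 (consSum_ne A hApos hdd x hx i)
  rw [consMap, norm_smul, norm_inv, norm_norm, inv_mul_cancel₀ this]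

lemma deriv_inj {n d : ℕ} (A : Matrix (Fin n) (Fin n) ℝ)
    (hApos : ∀ i j, 0 ≤ A i j)
    (hdd : ∀ i, Real.sqrt 2 * ∑ j ∈ Finset.univ.erase i, A i j < A i i)
    (x : CX n d) (hx : x ∈ CM n d) (v : CX n d) (hv : IsTan x v)
    (h0 : ∀ i, consSum A v i -
      (inner ℝ (consMap A x i) (consSum A v i) : ℝ) • consMap A x i = 0) : v = 0 := by
  rcases isEmpty_or_nonempty (Fin n) with hE | hE
  · exact Subsingleton.elim _ _
  obtain ⟨i, hi⟩ := Finite.exists_max (fun i => ‖v i‖)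
  have hf := consMap_mem A hApos hdd x hx i
  have b1 := perp_bound A hApos v i ‖v i‖ hi rfl _ hf (h0 i)
  have b2 := perp_bound A hApos x i 1 (fun j => (hx j).le) (hx i) _ hf (by
    have hn := norm_ne_zero_iff.2 (consSum_ne A hApos hdd x hx i)
    have e : consSum A x i = ‖consSum A x i‖ • consMap A x i := by
      rw [consMap, smul_smul, mul_inv_cancel₀ hn, one_smul]
    set f := consMap A x i
    set l := ‖consSum A x i‖
    rw [e, inner_smul_right, real_inner_self_eq_norm_sq, hf]
    simp)
  have b3 := bessel_two _ _ _ hf (hx i) (hv i)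
  have hr0 : 0 ≤ ∑ j ∈ Finset.univ.erase i, A i j := Finset.sum_nonneg fun j _ => hApos i j
  have h3 := hdd i
  set r := ∑ j ∈ Finset.univ.erase i, A i j
  set a := A i i
  have hra : 2 * r ^ 2 < a ^ 2 := by
    have : (Real.sqrt 2 * r) ^ 2 < a ^ 2 := pow_lt_pow_left₀ h3 (by positivity) (by norm_num)
    rwa [mul_pow, Real.sq_sqrt (by norm_num)] at this
  have ht : ‖v i‖ = 0 := by
    by_contra hne
    have hp : 0 < ‖v i‖ ^ 2 := by positivity
    set T := ‖v i‖ ^ 2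
    set p := (inner ℝ (consMap A x i) (x i) : ℝ) ^ 2
    set q := (inner ℝ (consMap A x i) (v i) : ℝ) ^ 2
    have c1 : a ^ 2 * (p * T + q) ≤ a ^ 2 * T := mul_le_mul_of_nonneg_left b3 (sq_nonneg _)
    have c2 := mul_le_mul_of_nonneg_right b2 hp.le
    have c3 := mul_lt_mul_of_pos_right hra hp
    nlinarith
  funext j
  have := hi j
  rw [ht] at this
  exact norm_le_zero_iff.1 this

lemma local_anti {n d : ℕ} (A : Matrix (Fin n) (Fin n) ℝ)
    (hApos : ∀ i j, 0 ≤ A i j)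
    (hdd : ∀ i, Real.sqrt 2 * ∑ j ∈ Finset.univ.erase i, A i j < A i i)
    (x : CX n d) (hx : x ∈ CM n d) :
    ∃ C > 0, ∃ U, IsOpen U ∧ x ∈ U ∧ ∀ y ∈ U, ∀ z ∈ U, y ∈ CM n d → z ∈ CM n d →
      dist y z ≤ C * dist (consMap A y) (consMap A z) := by
  obtain ⟨L, hL, hL'⟩ := consMap_deriv A x (consSum_ne A hApos hdd x hx)
  obtain ⟨C, hC, h1⟩ := anti_of_inj x L (fun v hv h0 => by
    apply deriv_inj A hApos hdd x hx v hv
    intro i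
    have := congrFun h0 i
    rw [hL'] at this
    have hn := norm_ne_zero_iff.2 (consSum_ne A hApos hdd x hx i)
    exact (smul_eq_zero.1 this).resolve_left (inv_ne_zero hn))
  have h2 := hL.isLittleO.bound (show 0 < 1 / (2 * C) by positivity)
  obtain ⟨U, hU, hxU, h3⟩ := exists_open_of_eventually_prod (h1.and h2)
  refine ⟨2 * C, by positivity, U, hU, hxU, ?_⟩
  intro y hy z hz hyM hzM
  obtain ⟨h4, h5⟩ := h3 y hy z hz
  have h4 := h4 hyM hzM
  simp only at h4 h5
  rw [dist_eq_norm, dist_eq_norm]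
  have h6 : ‖L (y - z)‖ ≤ ‖consMap A y - consMap A z‖ + 1 / (2 * C) * ‖y - z‖ := by
    have := norm_sub_norm_le (L (y - z)) (consMap A y - consMap A z)
    rw [norm_sub_rev (L (y - z))] at this
    linarith
  have h7 : ‖y - z‖ ≤ C * ‖consMap A y - consMap A z‖ + 1 / 2 * ‖y - z‖ := by
    calc _ ≤ C * (‖consMap A y - consMap A z‖ + 1 / (2 * C) * ‖y - z‖) := h4.trans (by gcongr)
      _ = _ := by field_simp
  linarith

lemma pullback_null {n d : ℕ} (A : Matrix (Fin n) (Fin n) ℝ)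
    (hApos : ∀ i j, 0 ≤ A i j)
    (hdd : ∀ i, Real.sqrt 2 * ∑ j ∈ Finset.univ.erase i, A i j < A i i)
    (r : ℝ) (hr : 0 ≤ r) (N : Set (CX n d)) (hN : μH[r] N = 0) :
    μH[r] {x | x ∈ CM n d ∧ consMap A x ∈ N} = 0 := by
  apply measure_null_of_locally_null
  rintro x ⟨hx, -⟩
  obtain ⟨C, hC, U, hU, hxU, h⟩ := local_anti A hApos hdd x hx
  refine ⟨{x | x ∈ CM n d ∧ consMap A x ∈ N} ∩ U, ?_, ?_⟩
  · exact Filter.inter_mem self_mem_nhdsWithin (mem_nhdsWithin_of_mem_nhds (hU.mem_nhds hxU))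
  · refine hnull_of_anti (consMap A) _ C r hr
      (fun y hy z hz => h y hy.2 z hz.2 hy.1.1 hz.1.1) ?_
    refine measure_mono_null ?_ hN
    rintro _ ⟨y, hy, rfl⟩
    exact hy.1.2

lemma pullback_iter_null {n d : ℕ} (A : Matrix (Fin n) (Fin n) ℝ)
    (hApos : ∀ i j, 0 ≤ A i j)
    (hdd : ∀ i, Real.sqrt 2 * ∑ j ∈ Finset.univ.erase i, A i j < A i i)
    (r : ℝ) (hr : 0 ≤ r) (N : Set (CX n d)) (hN : μH[r] N = 0) (k : ℕ) :
    μH[r] {x | x ∈ CM n d ∧ (consMap A)^[k] x ∈ N} = 0 := by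
  induction k with
  | zero => exact measure_mono_null (fun x hx => hx.2) hN
  | succ k ih =>
    refine measure_mono_null ?_ (pullback_null A hApos hdd r hr _ ih)
    intro x hx
    exact ⟨hx.1, consMap_mem A hApos hdd x hx.1, hx.2⟩

/-- Instability of non-consensus fixed points. -/
lemma exists_unstable {n d : ℕ} (hd : 3 ≤ d)
    (E : Fin n → Fin n → Prop)
    (hconn : ∀ i j, Relation.ReflTransGen E i j)
    (A : Matrix (Fin n) (Fin n) ℝ)
    (hApos : ∀ i j, 0 ≤ A i j)
    (hAE : ∀ i j, i ≠ j → (0 < A i j ↔ E i j))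
    (p : CX n d) (hp : p ∈ CM n d) (l : Fin n → ℝ) (hl : ∀ i, consSum A p i = l i • p i)
    (hne : ¬ ∀ i j, p i = p j) :
    ∃ v : CX n d, IsTan p v ∧
      ∑ i, l i * ‖v i‖ ^ 2 < ∑ i, ∑ j, A i j * inner ℝ (v i) (v j) := by
  let b := EuclideanSpace.basisFun (Fin d) ℝ
  let v : Fin d → CX n d := fun k i => b k - (inner ℝ (p i) (b k) : ℝ) • p i
  let c : Fin n → Fin n → ℝ := fun i j => inner ℝ (p i) (p j)
  have hpp : ∀ i, inner ℝ (p i) (p i) = (1:ℝ) := fun i => by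
    rw [real_inner_self_eq_norm_sq, hp i]; norm_num
  have hpars : ∀ i j, ∑ k, (inner ℝ (p i) (b k) : ℝ) * inner ℝ (p j) (b k) = c i j := by
    intro i j
    have := b.sum_inner_mul_inner (p i) (p j)
    refine Eq.trans ?_ this
    refine Finset.sum_congr rfl fun k _ => ?_
    rw [real_inner_comm (p j)]
  have hvv : ∀ i j, ∑ k, (inner ℝ (v k i) (v k j) : ℝ) = d - 2 + c i j ^ 2 := by
    intro i j
    have e : ∀ k, (inner ℝ (v k i) (v k j) : ℝ) = 1
        - (inner ℝ (p i) (b k) : ℝ) * inner ℝ (p i) (b k)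
        - (inner ℝ (p j) (b k) : ℝ) * inner ℝ (p j) (b k)
        + c i j * ((inner ℝ (p i) (b k) : ℝ) * inner ℝ (p j) (b k)) := by
      intro k
      have hb : (inner ℝ (b k) (b k) : ℝ) = 1 := by
        rw [real_inner_self_eq_norm_sq, b.orthonormal.1 k]; norm_num
      simp only [v, c, inner_sub_left, inner_sub_right, inner_smul_left, inner_smul_right, hb]
      rw [real_inner_comm (p j) (b k)]
      simp
      ring
    simp only [e, Finset.sum_add_distrib, Finset.sum_sub_distrib, ← Finset.mul_sum, hpars]
    simp only [c, hpp]
    simp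
    ring
  have hlc : ∀ i, l i = ∑ j, A i j * c i j := by
    intro i
    have := congrArg (fun u => (inner ℝ (p i) u : ℝ)) (hl i)
    simp only [consSum, inner_sum, inner_smul_right, hpp, mul_one] at this
    exact this.symm
  have hc1 : ∀ i j, c i j ≤ 1 := by
    intro i j
    have := real_inner_le_norm (p i) (p j)
    rwa [hp i, hp j, mul_one] at this
  have hd' : (3:ℝ) ≤ d := by exact_mod_cast hd
  have htot : 0 < ∑ k, (∑ i, ∑ j, A i j * (inner ℝ (v k i) (v k j) : ℝ)
      - ∑ i, l i * ‖v k i‖ ^ 2) := by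
    have e : ∑ k, (∑ i, ∑ j, A i j * (inner ℝ (v k i) (v k j) : ℝ)
      - ∑ i, l i * ‖v k i‖ ^ 2) = ∑ i, ∑ j, A i j * ((1 - c i j) * (d - 2 - c i j)) := by
      rw [Finset.sum_sub_distrib]
      have e1 : ∑ k, ∑ i, ∑ j, A i j * (inner ℝ (v k i) (v k j) : ℝ) =
          ∑ i, ∑ j, A i j * (d - 2 + c i j ^ 2) := by
        rw [Finset.sum_comm]
        refine Finset.sum_congr rfl fun i _ => ?_
        rw [Finset.sum_comm]
        refine Finset.sum_congr rfl fun j _ => ?_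
        rw [← Finset.mul_sum, hvv]
      have e2 : ∑ k, ∑ i, l i * ‖v k i‖ ^ 2 = ∑ i, ∑ j, A i j * c i j * (d - 1) := by
        rw [Finset.sum_comm]
        refine Finset.sum_congr rfl fun i _ => ?_
        simp only [← real_inner_self_eq_norm_sq]
        rw [← Finset.mul_sum, hvv, hlc, Finset.sum_mul]
        refine Finset.sum_congr rfl fun j _ => ?_
        simp only [c, hpp]
        ring
      rw [e1, e2, ← Finset.sum_sub_distrib]
      refine Finset.sum_congr rfl fun i _ => ?_
      rw [← Finset.sum_sub_distrib]
      refine Finset.sum_congr rfl fun j _ => ?_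
      ring
    rw [e]
    have hnn : ∀ i j, 0 ≤ A i j * ((1 - c i j) * (d - 2 - c i j)) := by
      intro i j
      have := hc1 i j
      exact mul_nonneg (hApos i j) (mul_nonneg (by linarith) (by linarith))
    by_contra hcon
    have hz : ∑ i, ∑ j, A i j * ((1 - c i j) * (d - 2 - c i j)) = 0 :=
      le_antisymm (not_lt.1 hcon) (Finset.sum_nonneg fun i _ => Finset.sum_nonneg fun j _ => hnn i j)
    apply hne
    intro i j
    induction hconn i j with
    | refl => rfl
    | @tail a a' _ hE ih =>
      rw [ih]
      by_cases haa : a = a'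
      · rw [haa]
      have hA := (hAE a a' haa).2 hE
      rw [Finset.sum_eq_zero_iff_of_nonneg
        (fun i _ => Finset.sum_nonneg fun j _ => hnn i j)] at hz
      have hz1 := hz a (Finset.mem_univ _)
      rw [Finset.sum_eq_zero_iff_of_nonneg (fun j _ => hnn a j)] at hz1
      have hz2 := hz1 a' (Finset.mem_univ _)
      have h1 := hc1 a a'
      have h2 : c a a' = 1 := by
        rcases mul_eq_zero.1 hz2 with h | h
        · exact absurd h hA.ne'
        rcases mul_eq_zero.1 h with h | h
        · linarith
        · linarith
      exact (inner_eq_one_iff_of_norm_eq_one (hp a) (hp a')).1 h2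
  obtain ⟨k, -, hk⟩ := Finset.exists_lt_of_sum_lt (s := Finset.univ) (f := fun _ : Fin d => (0:ℝ))
    (htot.trans_eq' (by simp))
  refine ⟨v k, ?_, by linarith⟩
  intro i
  simp only [v, inner_sub_right, inner_smul_right, hpp]
  ring

/-- The Hilbert space version of `CX`. -/
abbrev HX (n d : ℕ) := PiLp 2 (fun _ : Fin n => EuclideanSpace ℝ (Fin d))

/-- Diagonalisation of a symmetric matrix compressed to the tangent space. -/
lemma exists_eigen {n d : ℕ} (hd : 1 ≤ d) (B : Matrix (Fin n) (Fin n) ℝ)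
    (hB : ∀ i j, B i j = B j i) (p : CX n d) (hp : p ∈ CM n d) :
    ∃ m ≤ n * (d - 1), ∃ (μ : Fin m → ℝ) (κ : CX n d →L[ℝ] (Fin m → ℝ)),
      (∀ v, IsTan p v → κ v = 0 → v = 0) ∧
      (∀ v, IsTan p v → ∀ i, κ (consSum B v) i = μ i * κ v i) ∧
      (∀ s : Fin n → ℝ, κ (fun i => s i • p i) = 0) ∧
      ((∃ v, IsTan p v ∧ ∑ i, ‖v i‖ ^ 2 < ∑ i, ∑ j, B i j * inner ℝ (v i) (v j)) →
        ∃ i, 1 < |μ i|) := by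
  let T : Submodule ℝ (HX n d) :=
    { carrier := {v | ∀ i, inner ℝ (p i) (v i) = (0:ℝ)}
      add_mem' := by
        intro a b ha hb i
        simp only [Set.mem_ofPred_eq] at ha hb
        rw [PiLp.add_apply, inner_add_right, ha i, hb i, add_zero]
      zero_mem' := by intro i; simp
      smul_mem' := by
        intro c a ha i
        simp only [Set.mem_ofPred_eq] at ha
        rw [PiLp.smul_apply, inner_smul_right, ha i, mul_zero] }
  have hT : ∀ v : HX n d, v ∈ T ↔ ∀ i, inner ℝ (p i) (v i) = (0:ℝ) := fun v => Iff.rfl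
  let Bm : HX n d →ₗ[ℝ] HX n d :=
    { toFun := fun v => WithLp.toLp 2 (consSum B (fun i => v i))
      map_add' := by
        intro v w; ext1 i
        simp [consSum, Finset.sum_add_distrib]
      map_smul' := by
        intro c w; ext1 i
        simp [consSum, Finset.smul_sum, smul_comm c] }
  have hBm : ∀ v i, Bm v i = ∑ j, B i j • v j := fun v i => rfl
  have hBi : ∀ u v : HX n d, inner ℝ u (Bm v) = ∑ i, ∑ j, B i j * (inner ℝ (u i) (v j) : ℝ) := by
    intro u v
    rw [PiLp.inner_apply]
    simp only [hBm, inner_sum, inner_smul_right]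
  let Q : HX n d →ₗ[ℝ] T := (T.orthogonalProjectionOnto : HX n d →L[ℝ] T)
  have hQ : ∀ (u : T) (w : HX n d), inner ℝ u (Q w) = (inner ℝ (u : HX n d) w : ℝ) := by
    intro u w
    exact (Submodule.inner_orthogonalProjectionOnto_eq_of_mem_left u w)
  let C : T →ₗ[ℝ] T := Q ∘ₗ Bm ∘ₗ T.subtype
  have hCi : ∀ u v : T, inner ℝ u (C v) = (inner ℝ (u : HX n d) (Bm v) : ℝ) := fun u v => hQ u _
  have hC : LinearMap.IsSymmetric (𝕜 := ℝ) (E := T) C := by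
    intro u v
    rw [real_inner_comm, hCi, hCi, hBi, hBi, Finset.sum_comm]
    refine Finset.sum_congr rfl fun i _ => Finset.sum_congr rfl fun j _ => ?_
    rw [hB i j, real_inner_comm]
  let m := Module.finrank ℝ T
  let e := hC.eigenvectorBasis (n := m) rfl
  have hm : m ≤ n * (d - 1) := by
    let g : Fin n → HX n d := fun i => WithLp.toLp 2 (Pi.single i (p i))
    have hgi : ∀ (i : Fin n) (v : HX n d), inner ℝ (g i) v = (inner ℝ (p i) (v i) : ℝ) := by
      intro i v
      rw [PiLp.inner_apply, Finset.sum_eq_single i]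
      · simp [g]
      · intro j _ hj
        simp [g, Pi.single_eq_of_ne hj]
      · simp
    have hgo : LinearIndependent ℝ g := by
      apply linearIndependent_of_ne_zero_of_inner_eq_zero
      · intro i h
        have := hgi i (g i)
        rw [h, inner_zero_left] at this
        have h2 : (0 : HX n d) i = p i := by rw [← h]; simp [g]
        have := hp i
        rw [← h2] at this
        simp at this
      · intro i j hij
        change inner ℝ (g i) (g j) = (0:ℝ)
        rw [hgi]
        simp [g, Pi.single_eq_of_ne hij]
    have hspan : Submodule.span ℝ (Set.range g) ≤ Tᗮ := by
      rw [Submodule.span_le]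
      rintro _ ⟨i, rfl⟩
      rw [SetLike.mem_coe, Submodule.mem_orthogonal']
      intro u hu
      rw [hgi]; exact hu i
    have h1 := Submodule.finrank_mono hspan
    rw [finrank_span_eq_card hgo, Fintype.card_fin] at h1
    have h2 := Submodule.finrank_add_finrank_orthogonal T
    have h3 : Module.finrank ℝ (HX n d) = n * d := by
      have := (WithLp.linearEquiv 2 ℝ (Fin n → EuclideanSpace ℝ (Fin d))).finrank_eq
      rw [Module.finrank_pi_fintype] at this
      simpa using this
    have h4 : n * d = n * (d - 1) + n := by
      obtain ⟨d', rfl⟩ : ∃ d', d = d' + 1 := ⟨d - 1, by omega⟩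
      simp; ring
    change Module.finrank ℝ T ≤ _
    omega
  let κl : CX n d →ₗ[ℝ] (Fin m → ℝ) :=
    (WithLp.linearEquiv 2 ℝ (Fin m → ℝ)).toLinearMap ∘ₗ e.repr.toLinearEquiv.toLinearMap ∘ₗ
      Q ∘ₗ (WithLp.linearEquiv 2 ℝ (Fin n → EuclideanSpace ℝ (Fin d))).symm.toLinearMap
  have hκ : ∀ v i, κl v i = e.repr (Q (WithLp.toLp 2 v)) i := fun v i => rfl
  have hQT : ∀ v : CX n d, ∀ hv : IsTan p v,
      Q (WithLp.toLp 2 v) = (⟨WithLp.toLp 2 v, hv⟩ : T) := fun v hv =>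
    Submodule.orthogonalProjectionOnto_mem_subspace_eq_self (⟨WithLp.toLp 2 v, hv⟩ : T)
  refine ⟨m, hm, hC.eigenvalues rfl, LinearMap.toContinuousLinearMap κl, ?_, ?_, ?_, ?_⟩
  · intro v hv h
    have h1 : e.repr (Q (WithLp.toLp 2 v)) = 0 := by
      ext i
      exact congrFun h i
    rw [LinearIsometryEquiv.map_eq_zero_iff, hQT v hv] at h1
    have h2 := congrArg Subtype.val h1
    have h3 := congrArg WithLp.ofLp h2
    exact h3
  · intro v hv i
    change κl _ i = _ * κl _ i
    rw [hκ, hκ, hQT v hv]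
    exact hC.eigenvectorBasis_apply_self_apply rfl (⟨WithLp.toLp 2 v, hv⟩ : T) i
  · intro s
    funext i
    change κl _ i = _
    rw [hκ]
    have : Q (WithLp.toLp 2 fun i => s i • p i) = 0 := by
      apply ext_inner_left ℝ
      intro u
      rw [hQ, inner_zero_right, PiLp.inner_apply]
      refine Finset.sum_eq_zero fun j _ => ?_
      have := u.2 j
      simp only [inner_smul_right]
      rw [real_inner_comm]
      simp [this]
    rw [this]; simp
  · rintro ⟨v, hv, hlt⟩
    by_contra hcon
    push Not at hcon
    let u : T := ⟨WithLp.toLp 2 v, hv⟩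
    have h1 : inner ℝ u (C u) = ∑ i, ∑ j, B i j * (inner ℝ (v i) (v j) : ℝ) := by
      rw [hCi, hBi]
    have h2 : ‖u‖ ^ 2 = ∑ i, ‖v i‖ ^ 2 := by
      change ‖(WithLp.toLp 2 v : HX n d)‖ ^ 2 = _
      rw [PiLp.norm_sq_eq_of_L2]
    have h3 : (inner ℝ u (C u) : ℝ) ≤ ‖u‖ ^ 2 := by
      rw [← e.repr.inner_map_map, ← e.repr.norm_map u, PiLp.inner_apply,
        EuclideanSpace.norm_sq_eq]
      refine Finset.sum_le_sum fun i _ => ?_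
      have h4 : e.repr (C u) i = hC.eigenvalues rfl i * e.repr u i :=
        hC.eigenvectorBasis_apply_self_apply rfl u i
      have h5 := (abs_le.1 (hcon i)).2
      rw [h4, Real.norm_eq_abs, sq_abs]
      simp
      nlinarith [sq_nonneg (e.repr u i)]
    linarith

lemma fixed_nbhd {n d : ℕ} (hd : 3 ≤ d)
    (E : Fin n → Fin n → Prop)
    (hconn : ∀ i j, Relation.ReflTransGen E i j)
    (A : Matrix (Fin n) (Fin n) ℝ)
    (hAsym : A.IsSymm)
    (hApos : ∀ i j, 0 ≤ A i j)
    (hAE : ∀ i j, i ≠ j → (0 < A i j ↔ E i j))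
    (hdd : ∀ i, Real.sqrt 2 * ∑ j ∈ Finset.univ.erase i, A i j < A i i)
    (p : CX n d) (hp : p ∈ CM n d) (hfix : ∀ i, consMap A p i = p i)
    (hne : ¬ ∀ i j, p i = p j) :
    ∃ U, IsOpen U ∧ p ∈ U ∧
      μH[((n * (d - 1) : ℕ) : ℝ)] {x | x ∈ CM n d ∧ ∀ k, (consMap A)^[k] x ∈ U} = 0 := by
  let l : Fin n → ℝ := fun i => ‖consSum A p i‖
  have hs := consSum_ne A hApos hdd p hp
  have hl0 : ∀ i, 0 < l i := fun i => norm_pos_iff.2 (hs i)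
  have hl : ∀ i, consSum A p i = l i • p i := by
    intro i
    rw [← hfix i, consMap, smul_smul, mul_inv_cancel₀ (hl0 i).ne', one_smul]
  let q : Fin n → ℝ := fun i => Real.sqrt (l i)
  have hq0 : ∀ i, 0 < q i := fun i => Real.sqrt_pos.2 (hl0 i)
  have hqq : ∀ i, q i ^ 2 = l i := fun i => Real.sq_sqrt (hl0 i).le
  let B : Matrix (Fin n) (Fin n) ℝ := fun i j => A i j / (q i * q j)
  have hB : ∀ i j, B i j = B j i := by
    intro i j
    simp only [B]
    rw [hAsym.apply i j, mul_comm (q i)]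
  obtain ⟨v, hv, hvlt⟩ := exists_unstable hd E hconn A hApos hAE p hp l hl hne
  obtain ⟨m, hm, μ, κ, hinj, heig, hnor, hun⟩ := exists_eigen (by omega) B hB p hp
  have hex : ∃ i, 1 < |μ i| := by
    apply hun
    refine ⟨fun i => q i • v i, fun i => ?_, ?_⟩
    · rw [inner_smul_right, hv i, mul_zero]
    · convert hvlt using 1
      · refine Finset.sum_congr rfl fun i _ => ?_
        rw [norm_smul, mul_pow, Real.norm_eq_abs, sq_abs, hqq]
      · refine Finset.sum_congr rfl fun i _ => Finset.sum_congr rfl fun j _ => ?_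
        have h1 := (hq0 i).ne'
        have h2 := (hq0 j).ne'
        simp only [B, inner_smul_left, inner_smul_right]
        simp
        field_simp
  let S : CX n d →L[ℝ] CX n d := ContinuousLinearMap.pi fun i =>
    q i • ContinuousLinearMap.proj i
  have hS : ∀ v i, S v i = q i • v i := fun v i => rfl
  have hStan : ∀ v, IsTan p v → IsTan p (S v) := by
    intro v hv i
    rw [hS, inner_smul_right, hv i, mul_zero]
  let κ' := κ.comp S
  have hκ' : ∀ v, κ' v = κ (S v) := fun v => rfl
  obtain ⟨L, hL, hL'⟩ := consMap_deriv A p hs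
  let R : CX n d →L[ℝ] (Fin m → ℝ) := κ'.comp L -
    ContinuousLinearMap.pi fun i => μ i • (ContinuousLinearMap.proj i).comp κ'
  have hR : ∀ v i, R v i = κ' (L v) i - μ i * κ' v i := fun v i => rfl
  have hR0 : ∀ v, IsTan p v → R v = 0 := by
    intro v hv
    funext i
    rw [hR, hκ', hκ', ← heig (S v) (hStan v hv)]
    have e : S (L v) = consSum B (S v) -
        fun i => ((q i)⁻¹ * (inner ℝ (p i) (consSum A v i) : ℝ)) • p i := by
      funext i
      have h1 : consSum B (S v) i = (q i)⁻¹ • consSum A v i := by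
        simp only [consSum, Finset.smul_sum, hS, smul_smul, B]
        refine Finset.sum_congr rfl fun j _ => ?_
        congr 1
        have h1 := (hq0 i).ne'
        have h2 := (hq0 j).ne'
        field_simp
      have h2 : q i * (l i)⁻¹ = (q i)⁻¹ := by
        rw [← hqq i]
        have h1 := (hq0 i).ne'
        field_simp
      rw [hS, hL', Pi.sub_apply, h1, hfix, smul_smul]
      change (q i * (l i)⁻¹) • _ = _
      rw [h2, smul_sub, smul_smul]
    rw [e, map_sub, hnor, sub_zero, sub_self]
    rfl
  obtain ⟨C, hC, h1⟩ := anti_of_inj p κ' (fun v hv h0 => by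
    have := hinj (S v) (hStan v hv) h0
    funext i
    have h2 := congrFun this i
    rw [hS] at h2
    exact (smul_eq_zero.1 h2).resolve_left (hq0 i).ne')
  obtain ⟨c, hc1, hc⟩ : ∃ c : ℝ, 1 < c ∧ ∀ i, 1 < |μ i| → c ≤ |μ i| := by
    have hne : (Finset.univ.filter fun i => 1 < |μ i|).Nonempty := by
      obtain ⟨i, hi⟩ := hex
      exact ⟨i, by simpa using hi⟩
    obtain ⟨i, hi, hi'⟩ := Finset.exists_min_image _ (fun i => |μ i|) hne
    refine ⟨|μ i|, by simpa using hi, fun j hj => hi' j (by simpa using hj)⟩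
  set ε := (c - 1) / 4 with hε
  have hε0 : 0 < ε := by rw [hε]; linarith
  set η := ε / ((‖κ'‖ + 1) * C) with hη
  have hη0 : 0 < η := by positivity
  have h2 := hL.isLittleO.bound hη0
  have h3 := small_of_vanish p hp R hR0 η hη0
  obtain ⟨U, hU, hpU, h4⟩ := exists_open_of_eventually_prod ((h1.and h2).and h3)
  refine ⟨U, hU, hpU, ?_⟩
  refine unstable_null hm (consMap A) (CM n d) U (consMap_mem A hApos hdd) κ' C μ c ε (‖κ'‖ * 2)
    (by rw [hε]; linarith) hε0 hc hex ?_ ?_ ?_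
  · rintro y ⟨hyM, hyU⟩ z ⟨hzM, hzU⟩
    rw [dist_eq_norm, dist_eq_norm, ← map_sub]
    exact (h4 y hyU z hzU).1.1 hyM hzM
  · rintro y ⟨hyM, hyU⟩ z ⟨hzM, hzU⟩ i
    obtain ⟨⟨a1, a2⟩, a3⟩ := h4 y hyU z hzU
    have a1 := a1 hyM hzM
    have a3 := a3 hyM hzM
    simp only at a1 a2 a3
    have e : (κ' (consMap A y) i - κ' (consMap A z) i) - μ i * (κ' y i - κ' z i) =
        κ' (consMap A y - consMap A z - L (y - z)) i + R (y - z) i := by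
      rw [hR]
      simp only [map_sub, Pi.sub_apply]
      ring
    rw [e, dist_eq_norm, ← map_sub]
    have b1 : |κ' (consMap A y - consMap A z - L (y - z)) i| ≤ ‖κ'‖ * (η * ‖y - z‖) :=
      (norm_le_pi_norm _ i).trans ((κ'.le_opNorm _).trans (by gcongr))
    have b2 : |R (y - z) i| ≤ η * ‖y - z‖ := (norm_le_pi_norm (R (y - z)) i).trans a3
    calc _ ≤ _ := abs_add_le _ _
      _ ≤ ‖κ'‖ * (η * ‖y - z‖) + η * ‖y - z‖ := add_le_add b1 b2
      _ = (‖κ'‖ + 1) * η * ‖y - z‖ := by ring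
      _ ≤ (‖κ'‖ + 1) * η * (C * ‖κ' (y - z)‖) := by gcongr
      _ = ε * ‖κ' (y - z)‖ := by rw [hη]; field_simp
  · rintro y ⟨hyM, hyU⟩ z ⟨hzM, hzU⟩
    rw [dist_eq_norm, ← map_sub]
    refine (κ'.le_opNorm _).trans ?_
    gcongr
    rw [pi_norm_le_iff_of_nonneg (by norm_num)]
    intro i
    have := norm_sub_le (y i) (z i)
    rw [hyM i, hzM i] at this
    rw [Pi.sub_apply]
    linarith

lemma bad_null {n d : ℕ} (hd : 3 ≤ d)
    (E : Fin n → Fin n → Prop)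
    (hconn : ∀ i j, Relation.ReflTransGen E i j)
    (A : Matrix (Fin n) (Fin n) ℝ)
    (hAsym : A.IsSymm)
    (hApos : ∀ i j, 0 ≤ A i j)
    (hAE : ∀ i j, i ≠ j → (0 < A i j ↔ E i j))
    (hdd : ∀ i, Real.sqrt 2 * ∑ j ∈ Finset.univ.erase i, A i j < A i i) :
    μH[((n * (d - 1) : ℕ) : ℝ)] {x : CX n d | x ∈ CM n d ∧ ∃ p : CX n d, p ∈ CM n d ∧
      (∀ i, consMap A p i = p i) ∧ (¬ ∀ i j, p i = p j) ∧
      Filter.Tendsto (fun k => (consMap A)^[k] x) Filter.atTop (nhds p)} = 0 := by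
  classical
  set F : Set (CX n d) := {p | p ∈ CM n d ∧ (∀ i, consMap A p i = p i) ∧ ¬ ∀ i j, p i = p j}
    with hF
  have key : ∀ p : CX n d, ∃ U, p ∈ F → IsOpen U ∧ p ∈ U ∧
      μH[((n * (d - 1) : ℕ) : ℝ)] {x | x ∈ CM n d ∧ ∀ k, (consMap A)^[k] x ∈ U} = 0 := by
    intro p
    by_cases hp : p ∈ F
    · obtain ⟨U, hU⟩ := fixed_nbhd hd E hconn A hAsym hApos hAE hdd p hp.1 hp.2.1 hp.2.2
      exact ⟨U, fun _ => hU⟩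
    · exact ⟨∅, fun h => absurd h hp⟩
  choose U hU using key
  obtain ⟨t, htF, htc, hcov⟩ := TopologicalSpace.countable_cover_nhdsWithin (f := U) (s := F)
    (fun p hp => mem_nhdsWithin_of_mem_nhds ((hU p hp).1.mem_nhds (hU p hp).2.1))
  have hnull : μH[((n * (d - 1) : ℕ) : ℝ)] (⋃ p ∈ t, ⋃ K : ℕ, {x : CX n d | x ∈ CM n d ∧
      (consMap A)^[K] x ∈ {x | x ∈ CM n d ∧ ∀ k, (consMap A)^[k] x ∈ U p}}) = 0 := by
    rw [measure_biUnion_null_iff htc]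
    intro p hp
    rw [measure_iUnion_null_iff]
    intro K
    exact pullback_iter_null A hApos hdd _ (by positivity) _ (hU p (htF hp)).2.2 K
  refine measure_mono_null ?_ hnull
  rintro x ⟨hx, p, hp, hfix, hne, hlim⟩
  obtain ⟨q, hq, hpq⟩ := Set.mem_iUnion₂.1 (hcov (show p ∈ F from ⟨hp, hfix, hne⟩))
  have hev := hlim.eventually ((hU q (htF hq)).1.mem_nhds hpq)
  obtain ⟨K, hK⟩ := Filter.eventually_atTop.1 hev
  refine Set.mem_iUnion₂.2 ⟨q, hq, Set.mem_iUnion.2 ⟨K, hx, ?_, fun k => ?_⟩⟩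
  · clear hK
    induction K with
    | zero => exact hx
    | succ k ih => rw [Function.iterate_succ_apply']; exact consMap_mem A hApos hdd _ ih
  · rw [← Function.iterate_add_apply]
    exact hK _ (by omega)

/-- for `d ≥ 3`, a connected symmetric graph and a symmetric weight matrix
with `a_ii > √2 Σ_{j≠i} a_ij`, the set of (configurations identified with) points of
`ℝ^{nd}` whose forward orbit under `f_A` converges to a non-consensus fixed point has
`n(d−1)`-dimensional Hausdorff measure zero. -/
theorem stmt_15 (n d : ℕ) (hn : 1 ≤ n) (hd : 3 ≤ d)
    (E : Fin n → Fin n → Prop)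
    (hEsym : ∀ i j, E i j → E j i)
    (hconn : ∀ i j, Relation.ReflTransGen E i j)
    (A : Matrix (Fin n) (Fin n) ℝ)
    (hAsym : A.IsSymm)
    (hApos : ∀ i j, 0 ≤ A i j)
    (hAE : ∀ i j, i ≠ j → (0 < A i j ↔ E i j))
    (hdd : ∀ i, Real.sqrt 2 * ∑ j ∈ Finset.univ.erase i, A i j < A i i) :
    μH[((n * (d - 1) : ℕ) : ℝ)]
      ({v : EuclideanSpace ℝ (Fin n × Fin d) |
        ∃ x : Fin n → EuclideanSpace ℝ (Fin d),
          (∀ i, ‖x i‖ = 1) ∧ (∀ i a, v (i, a) = x i a) ∧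
          ∃ xinf : Fin n → EuclideanSpace ℝ (Fin d),
            (∀ i, ‖xinf i‖ = 1) ∧
            (∀ i, consMap A xinf i = xinf i) ∧
            (¬ ∀ i j, xinf i = xinf j) ∧
            Filter.Tendsto (fun k => (consMap A)^[k] x) Filter.atTop (nhds xinf)} :
        Set (EuclideanSpace ℝ (Fin n × Fin d))) = 0 := by
  let Φl : CX n d →ₗ[ℝ] EuclideanSpace ℝ (Fin n × Fin d) :=
    { toFun := fun x => WithLp.toLp 2 (fun q => x q.1 q.2)
      map_add' := by intro x y; ext q; simp
      map_smul' := by intro c x; ext q; simp }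
  let Φ := LinearMap.toContinuousLinearMap Φl
  have hΦ := Φ.lipschitz.hausdorffMeasure_image_le
    (d := ((n * (d - 1) : ℕ) : ℝ)) (by positivity)
    {x : CX n d | x ∈ CM n d ∧ ∃ p : CX n d, p ∈ CM n d ∧
      (∀ i, consMap A p i = p i) ∧ (¬ ∀ i j, p i = p j) ∧
      Filter.Tendsto (fun k => (consMap A)^[k] x) Filter.atTop (nhds p)}
  rw [bad_null hd E hconn A hAsym hApos hAE hdd, mul_zero] at hΦ
  refine measure_mono_null ?_ (le_antisymm hΦ bot_le)
  rintro v ⟨x, hx, hvx, p, hp, hfix, hne, hlim⟩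
  refine ⟨x, ⟨hx, p, hp, hfix, hne, hlim⟩, ?_⟩
  ext q
  exact (hvx q.1 q.2).symm

end
end

section
/- Let n ≥ 2 and d ≥ 2. Then the set of matrices A = [a_ij] ∈ ℝ^{n×n} such that (i) all entries of A are strictly positive, (ii) A is strictly diagonally dominant, and (iii) there exists a fixed point x of the consensus map f_A that is not an antipodal-consensus configuration (i.e. the n×d matrix with rows x_i^T has rank at least 2), has Lebesgue measure zero in ℝ^{n×n} ≅ ℝ^{n²}. (This is the complete-graph case: every off-diagonal entry positive.) -/
open scoped BigOperators

section Aux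

variable {E : Type*} [NormedAddCommGroup E] [NormedSpace ℝ E]

theorem aux_prod_diff {ι : Type*} (u : Finset ι) (f : ι → E → ℝ) (p : E)
    (h : ∀ i, DifferentiableAt ℝ (f i) p) :
    DifferentiableAt ℝ (fun q => ∏ i ∈ u, f i q) p := by
  classical
  induction u using Finset.induction_on with
  | empty => simp
  | insert a s ha ih =>
    simp only [Finset.prod_insert ha]
    exact (h a).mul ih

theorem aux_det_diff {ι : Type*} [Fintype ι] [DecidableEq ι] (N : E → Matrix ι ι ℝ) (p : E)
    (h : ∀ i j, DifferentiableAt ℝ (fun q => N q i j) p) :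
    DifferentiableAt ℝ (fun q => (N q).det) p := by
  simp only [Matrix.det_apply']
  refine DifferentiableAt.fun_sum fun σ _ => ?_
  exact (differentiableAt_const _).mul (aux_prod_diff _ _ _ fun i => h _ _)

theorem aux_inv_diff {ι : Type*} [Fintype ι] [DecidableEq ι] (N : E → Matrix ι ι ℝ) (p : E)
    (h : ∀ i j, DifferentiableAt ℝ (fun q => N q i j) p) (hp : (N p).det ≠ 0) (i j : ι) :
    DifferentiableAt ℝ (fun q => (N q)⁻¹ i j) p := by
  simp only [Matrix.inv_def, Ring.inverse_eq_inv', Matrix.smul_apply, smul_eq_mul,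
    Matrix.adjugate_apply]
  refine ((aux_det_diff N p h).inv hp).mul (aux_det_diff _ p fun k l => ?_)
  by_cases hk : k = j
  · subst hk
    simp only [Matrix.updateRow_self]
    exact differentiableAt_const _
  · simp only [Matrix.updateRow_ne hk]
    exact h _ _

end Aux

noncomputable section Param

variable {n r : ℕ}

/-- the normalized configuration encoded in the parameter. -/
def pX (e : Fin r → Fin n) (p : Fin n → Fin n → ℝ) (i : Fin n) (l : Fin r) : ℝ :=
  p i (e l) / Real.sqrt (∑ k, p i (e k) ^ 2)

/-- the basis submatrix. -/
def pM (e : Fin r → Fin n) (p : Fin n → Fin n → ℝ) : Matrix (Fin r) (Fin r) ℝ :=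
  Matrix.of fun k l => pX e p (e k) l

open Classical in
/-- right-hand side of the linear system. -/
def pW (e : Fin r → Fin n) (p : Fin n → Fin n → ℝ) (i : Fin n) (l : Fin r) : ℝ :=
  p i (e l) - ∑ j, if (∃ k, e k = j) then 0 else p i j * pX e p j l

open Classical in
/-- the parametrization of matrices. -/
def pF (e : Fin r → Fin n) (p : Fin n → Fin n → ℝ) (i : Fin n) (j : Fin n) : ℝ :=
  if h : ∃ k, e k = j then ∑ l, pW e p i l * (pM e p)⁻¹ l h.choose else p i j

/-- the gauge-fixed parameter set. -/
def pS (e : Fin r → Fin n) (i₀ : Fin n) (k₀ : Fin r) : Set (Fin n → Fin n → ℝ) :=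
  {p | p i₀ (e k₀) = 0 ∧ (∀ i, ∑ k, p i (e k) ^ 2 ≠ 0) ∧ (pM e p).det ≠ 0}

theorem pF_diff (e : Fin r → Fin n) (i₀ : Fin n) (k₀ : Fin r) :
    DifferentiableOn ℝ (pF e) (pS e i₀ k₀) := by
  intro p hp
  apply DifferentiableAt.differentiableWithinAt
  obtain ⟨-, h1, h2⟩ := hp
  have hc : ∀ i j, DifferentiableAt ℝ (fun q : Fin n → Fin n → ℝ => q i j) p := by
    intro i j; fun_prop
  have hX : ∀ i l, DifferentiableAt ℝ (fun q => pX e q i l) p := by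
    intro i l
    unfold pX
    have hq : DifferentiableAt ℝ (fun q : Fin n → Fin n → ℝ => ∑ k, q i (e k) ^ 2) p :=
      DifferentiableAt.fun_sum fun k _ => (hc _ _).pow 2
    simp only [div_eq_mul_inv]
    refine (hc _ _).mul ((hq.sqrt (h1 i)).inv ?_)
    · rw [Real.sqrt_ne_zero (Finset.sum_nonneg fun _ _ => sq_nonneg _)]
      exact h1 i
  have hW : ∀ i l, DifferentiableAt ℝ (fun q => pW e q i l) p := by
    intro i l
    unfold pW
    refine (hc _ _).sub (DifferentiableAt.fun_sum fun j _ => ?_)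
    split_ifs
    · exact differentiableAt_const _
    · exact (hc _ _).mul (hX _ _)
  have hI : ∀ k l, DifferentiableAt ℝ (fun q => (pM e q)⁻¹ k l) p := by
    intro k l
    exact aux_inv_diff _ _ (fun k l => hX _ _) h2 k l
  rw [differentiableAt_pi]
  intro i
  rw [differentiableAt_pi]
  intro j
  unfold pF
  split_ifs with h
  · exact DifferentiableAt.fun_sum fun l _ => (hW _ _).mul (hI _ _)
  · exact hc _ _

theorem pS_null (e : Fin r → Fin n) (i₀ : Fin n) (k₀ : Fin r) :
    MeasureTheory.volume (pS e i₀ k₀) = 0 := by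
  let L : (Fin n → Fin n → ℝ) →ₗ[ℝ] ℝ :=
    (LinearMap.proj (e k₀)).comp (LinearMap.proj (R := ℝ) (φ := fun _ => Fin n → ℝ) i₀)
  have hL : LinearMap.ker L ≠ ⊤ := by
    intro h
    have : (fun _ _ => 1 : Fin n → Fin n → ℝ) ∈ LinearMap.ker L := by rw [h]; trivial
    simp [L] at this
  refine MeasureTheory.measure_mono_null ?_
    (MeasureTheory.Measure.addHaar_submodule MeasureTheory.volume _ hL)
  intro p hp
  exact hp.1

theorem pF_image_null (e : Fin r → Fin n) (i₀ : Fin n) (k₀ : Fin r) :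
    MeasureTheory.volume (pF e '' pS e i₀ k₀) = 0 :=
  MeasureTheory.addHaar_image_eq_zero_of_differentiableOn_of_addHaar_eq_zero _
    (pF_diff e i₀ k₀) (pS_null e i₀ k₀)

theorem mem_image (e : Fin r → Fin n) (i₀ : Fin n) (k₀ : Fin r)
    (a : Fin n → Fin n → ℝ) (z : Fin n → EuclideanSpace ℝ (Fin r)) (c : Fin n → ℝ)
    (hz : ∀ i, ‖z i‖ = 1) (hc : ∀ i, 0 < c i)
    (hfix : ∀ i, ∑ j, a i j • z j = c i • z i)
    (hli : LinearIndependent ℝ (fun k => z (e k))) (h0 : z i₀ k₀ = 0) :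
    a ∈ pF e '' pS e i₀ k₀ := by
  classical
  have he : Function.Injective e := fun k l h => hli.injective (by simp [h])
  let p : Fin n → Fin n → ℝ := fun i => Function.extend e (fun k => c i * z i k) (a i)
  have p1 : ∀ i k, p i (e k) = c i * z i k := fun i k => he.extend_apply _ _ _
  have p2 : ∀ i j, (¬ ∃ k, e k = j) → p i j = a i j :=
    fun i j h => Function.extend_apply' _ _ _ h
  have hz2 : ∀ i, ∑ k, z i k ^ 2 = 1 := by
    intro i
    have := EuclideanSpace.real_norm_sq_eq (z i)
    rw [← this, hz]; norm_num
  have hs : ∀ i, ∑ k, p i (e k) ^ 2 = c i ^ 2 := by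
    intro i
    simp only [p1, mul_pow, ← Finset.mul_sum, hz2, mul_one]
  have hX : ∀ i l, pX e p i l = z i l := by
    intro i l
    unfold pX
    rw [hs, Real.sqrt_sq (hc i).le, p1, mul_div_cancel_left₀ _ (hc i).ne']
  have hM : IsUnit (pM e p) := by
    rw [← Matrix.linearIndependent_rows_iff_isUnit]
    have := hli.map' (WithLp.linearEquiv 2 ℝ (Fin r → ℝ)).toLinearMap (LinearEquiv.ker _)
    have hrow : (pM e p).row = ((WithLp.linearEquiv 2 ℝ (Fin r → ℝ)).toLinearMap ∘
        fun k => z (e k)) := by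
      funext k l
      simp [pM, hX, Matrix.row]
    rw [hrow]
    exact this
  have hdet : IsUnit (pM e p).det := (Matrix.isUnit_iff_isUnit_det _).1 hM
  refine ⟨p, ⟨?_, ?_, hdet.ne_zero⟩, ?_⟩
  · rw [p1, h0, mul_zero]
  · intro i
    rw [hs]; exact pow_ne_zero 2 (hc i).ne'
  · have hsplit : ∀ (g : Fin n → ℝ), ∑ j, g j = ∑ k, g (e k) +
        ∑ j, (if (∃ k, e k = j) then 0 else g j) := by
      intro g
      have h1 : ∑ k, g (e k) = ∑ j, (if (∃ k, e k = j) then g j else 0) := by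
        rw [← Finset.sum_filter, ← Finset.sum_image (s := Finset.univ) (g := e) (f := g)
          (fun x _ y _ h => he h)]
        congr 1
        ext j
        simp
      rw [h1, ← Finset.sum_add_distrib]
      refine Finset.sum_congr rfl fun j _ => ?_
      split_ifs <;> simp
    have hW : ∀ i, pW e p i = Matrix.vecMul (fun k => a i (e k)) (pM e p) := by
      intro i
      ext l
      have h1 : ∑ j, a i j * z j l = c i * z i l := by
        have := congrArg (fun v : EuclideanSpace ℝ (Fin r) => v l) (hfix i)
        simpa using this
      rw [hsplit] at h1
      have h2 : pW e p i l = c i * z i l -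
          ∑ j, (if (∃ k, e k = j) then 0 else a i j * z j l) := by
        unfold pW
        rw [p1]
        congr 1
        refine Finset.sum_congr rfl fun j _ => ?_
        by_cases h : ∃ k, e k = j
        · simp only [if_pos h]
        · simp only [if_neg h]
          rw [p2 i j h, hX]
      rw [h2]
      simp only [Matrix.vecMul, dotProduct, pM, Matrix.of_apply, hX]
      linarith
    funext i j
    unfold pF
    split_ifs with h
    · have h3 : Matrix.vecMul (pW e p i) (pM e p)⁻¹ = fun k => a i (e k) := by
        rw [hW, Matrix.vecMul_vecMul, Matrix.mul_nonsing_inv _ hdet, Matrix.vecMul_one]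
      have h4 := congrFun h3 h.choose
      simp only [Matrix.vecMul, dotProduct] at h4
      rw [h4, h.choose_spec]
    · exact p2 i j h

end Param

theorem exists_gauge {n d : ℕ} (hn : 2 ≤ n) (x : Fin n → EuclideanSpace ℝ (Fin d))
    (hx : ∀ i, ‖x i‖ = 1)
    (hna : ¬ ∃ (xbar : EuclideanSpace ℝ (Fin d)) (s : Fin n → ℝ),
              ‖xbar‖ = 1 ∧ (∀ i, s i = 1 ∨ s i = -1) ∧ ∀ i, x i = s i • xbar) :
    ∃ (r : ℕ) (e : Fin r → Fin n) (i₀ : Fin n) (k₀ : Fin r)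
      (z : Fin n → EuclideanSpace ℝ (Fin r)), (∀ i, ‖z i‖ = 1) ∧
      (∀ (a : Fin n → ℝ) (c : ℝ) i, ∑ j, a j • x j = c • x i → ∑ j, a j • z j = c • z i) ∧
      LinearIndependent ℝ (fun k => z (e k)) ∧ z i₀ k₀ = 0 := by
  classical
  let S := Submodule.span ℝ (Set.range x)
  obtain ⟨f, hf1, hf3⟩ : ∃ f : Fin (Module.finrank ℝ S) → EuclideanSpace ℝ (Fin d),
      (∀ i, f i ∈ Set.range x) ∧ LinearIndependent ℝ f := by
    obtain ⟨f, h1, _, h3⟩ := Submodule.exists_fun_fin_finrank_span_eq ℝ (Set.range x)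
    exact ⟨f, h1, h3⟩
  choose e he using hf1
  let y : Fin n → S := fun i => ⟨x i, Submodule.subset_span ⟨i, rfl⟩⟩
  let i₀ : Fin n := ⟨0, by omega⟩
  have hy : ∀ i, ‖y i‖ = 1 := hx
  have hy0 : y i₀ ≠ 0 := by
    intro h; have := hy i₀; rw [h] at this; simp at this
  have hr : 2 ≤ Module.finrank ℝ S := by
    by_contra hlt
    apply hna
    have h1 : Module.finrank ℝ S = 1 := by
      have : 0 < Module.finrank ℝ S := Module.finrank_pos_iff_exists_ne_zero.2 ⟨_, hy0⟩
      omega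
    have h2 := (finrank_eq_one_iff_of_nonzero' (y i₀) hy0).1 h1
    choose s hs using fun i => h2 (y i)
    refine ⟨x i₀, s, hx _, fun i => ?_, fun i => ?_⟩
    · have := congrArg norm (hs i)
      rw [norm_smul, hy, hy, mul_one, Real.norm_eq_abs] at this
      exact eq_or_eq_neg_of_abs_eq this
    · have := congrArg Subtype.val (hs i)
      exact this.symm
  have hw : ∃ w : S, ‖w‖ = 1 ∧ inner ℝ w (y i₀) = 0 := by
    have h1 := Submodule.finrank_add_finrank_orthogonal (Submodule.span ℝ {y i₀})
    rw [finrank_span_singleton hy0] at h1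
    have h2 : (Submodule.span ℝ {y i₀})ᗮ ≠ ⊥ := by
      intro h
      rw [h, finrank_bot] at h1
      omega
    obtain ⟨v, hv, hv0⟩ := Submodule.exists_mem_ne_zero_of_ne_bot h2
    refine ⟨‖v‖⁻¹ • v, norm_smul_inv_norm hv0, ?_⟩
    refine (real_inner_smul_left v (y i₀) ‖v‖⁻¹).trans ?_
    rw [Submodule.mem_orthogonal_singleton_iff_inner_left.1 hv, mul_zero]
  obtain ⟨w, hw1, hw2⟩ := hw
  let k₀ : Fin (Module.finrank ℝ S) := ⟨0, by omega⟩
  obtain ⟨b, hb⟩ := Orthonormal.exists_orthonormalBasis_extension_of_card_eq (𝕜 := ℝ) (E := S)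
    (ι := Fin (Module.finrank ℝ S)) (by simp) (v := fun _ => w) (s := {k₀}) (by
      constructor
      · intro i; exact hw1
      · intro i j hij; exact absurd (Subsingleton.elim i j) hij)
  refine ⟨Module.finrank ℝ S, e, i₀, k₀, fun i => b.repr (y i), ?_, ?_, ?_, ?_⟩
  · intro i; simp [hy]
  · intro a c i h
    have : ∑ j, a j • y j = c • y i := by
      apply Subtype.ext
      simpa [y] using h
    rw [← map_smul, ← this, map_sum]
    simp
  · have h1 : LinearIndependent ℝ (fun k => y (e k)) := by
      apply LinearIndependent.of_comp S.subtype
      have h2 : (S.subtype ∘ fun k => y (e k)) = f := funext he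
      rw [h2]
      exact hf3
    exact h1.map' b.repr.toLinearEquiv.toLinearMap (LinearEquiv.ker _)
  · simp only [OrthonormalBasis.repr_apply_apply]
    rw [hb k₀ rfl, hw2]

/-- complete-graph case: for `n ≥ 2`, `d ≥ 2`, the set of matrices
`A ∈ ℝ^{n×n}` with all entries strictly positive, strictly diagonally dominant, and
admitting a fixed point of the consensus map that is not an antipodal-consensus
configuration, has Lebesgue measure zero in `ℝ^{n²}`. -/
theorem stmt_19 (n d : ℕ) (hn : 2 ≤ n) (hd : 2 ≤ d) :
    MeasureTheory.volume
      {a : Fin n → Fin n → ℝ |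
        (∀ i j, 0 < a i j) ∧
        (∀ i, ∑ j ∈ Finset.univ.erase i, a i j < a i i) ∧
        ∃ x : Fin n → EuclideanSpace ℝ (Fin d),
          (∀ i, ‖x i‖ = 1) ∧
          (∀ i, ‖∑ j, a i j • x j‖⁻¹ • ∑ j, a i j • x j = x i) ∧
          ¬ ∃ (xbar : EuclideanSpace ℝ (Fin d)) (s : Fin n → ℝ),
              ‖xbar‖ = 1 ∧ (∀ i, s i = 1 ∨ s i = -1) ∧ ∀ i, x i = s i • xbar} = 0 := by
  refine MeasureTheory.measure_mono_null
    (t := ⋃ (r : ℕ), ⋃ (e : Fin r → Fin n), ⋃ (i₀ : Fin n), ⋃ (k₀ : Fin r),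
      pF e '' pS e i₀ k₀) ?_ ?_
  · rintro a ⟨-, -, x, hx, hfix, hna⟩
    obtain ⟨r, e, i₀, k₀, z, hz, hlin, hli, h0⟩ := exists_gauge hn x hx hna
    have hpos : ∀ i, 0 < ‖∑ j, a i j • x j‖ := by
      intro i
      rw [norm_pos_iff]
      intro h
      have h1 := hfix i
      rw [h, smul_zero] at h1
      have h2 := hx i
      rw [← h1] at h2
      simp at h2
    simp only [Set.mem_iUnion]
    refine ⟨r, e, i₀, k₀, mem_image e i₀ k₀ a z (fun i => ‖∑ j, a i j • x j‖) hz hpos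
      (fun i => hlin _ _ _ ?_) hli h0⟩
    conv_rhs => rw [← hfix i]
    rw [smul_smul, mul_inv_cancel₀ (hpos i).ne', one_smul]
  · simp only [MeasureTheory.measure_iUnion_null_iff]
    intro r e i₀ k₀
    exact pF_image_null e i₀ k₀
end
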